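/- Under the stated assumptions on the Hermitian-matrix-valued solution g of the elliptic system, for every γ with α < γ < 1 there is a constant C depending only on n, α, γ, σ, Λ and M such that sup_{B_{3/4}} |g| + sup_{x≠y ∈ B_{3/4}} |g(x)−g(y)|/|x−y|^γ ≤ C. -/

import Mathlib

open Matrix MeasureTheory

noncomputable instance (n : ℕ) : MeasurableSpace (EuclideanSpace ℂ (Fin n)) := borel _
instance (n : ℕ) : BorelSpace (EuclideanSpace ℂ (Fin n)) := ⟨rfl⟩

/-- The real partial derivative `∂_{x_k} f` (direction of the real part of `z_k`). -/
noncomputable def pdx (n : ℕ) (k : Fin n) (f : EuclideanSpace ℂ (Fin n) → ℂ)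
    (z : EuclideanSpace ℂ (Fin n)) : ℂ :=
  fderiv ℝ f z (EuclideanSpace.single k (1 : ℂ))

/-- The real partial derivative `∂_{y_k} f` (direction of the imaginary part of `z_k`). -/
noncomputable def pdy (n : ℕ) (k : Fin n) (f : EuclideanSpace ℂ (Fin n) → ℂ)
    (z : EuclideanSpace ℂ (Fin n)) : ℂ :=
  fderiv ℝ f z (EuclideanSpace.single k Complex.I)

/-- The Wirtinger derivative `∂_k = ½(∂_{x_k} − i ∂_{y_k})`. -/
noncomputable def wirt (n : ℕ) (k : Fin n) (f : EuclideanSpace ℂ (Fin n) → ℂ)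
    (z : EuclideanSpace ℂ (Fin n)) : ℂ :=
  (pdx n k f z - Complex.I * pdy n k f z) / 2

/-- The conjugate Wirtinger derivative `∂_{k̄} = ½(∂_{x_k} + i ∂_{y_k})`. -/
noncomputable def wirtBar (n : ℕ) (k : Fin n) (f : EuclideanSpace ℂ (Fin n) → ℂ)
    (z : EuclideanSpace ℂ (Fin n)) : ℂ :=
  (pdx n k f z + Complex.I * pdy n k f z) / 2

/-- The hypotheses on the Hermitian-matrix-valued solution `g` of the elliptic system
`g^{kl̄} ∂_k ∂_{l̄} g_{ij̄} − g^{km̄} g^{pl̄} (∂_p g_{im̄})(∂_{l̄} g_{kj̄}) = c g_{ij̄} + H_{ij̄}`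
on the unit ball `B₁ ⊆ ℂⁿ`:
smoothness of `g`, pointwise Hermitianity, the two-sided bound `σ⁻¹·Id ≤ g ≤ σ·Id`,
continuity of `H` together with `|c| + sup |H| ≤ Λ`, the `α`-Hölder bound `M` for `g`,
and the equation itself (with `g^{kl̄}` the entries of the pointwise inverse matrix). -/
def EllipticSolution (n : ℕ) (α σ Λ M c : ℝ)
    (g H : EuclideanSpace ℂ (Fin n) → Matrix (Fin n) (Fin n) ℂ) : Prop :=
  (∀ i j : Fin n, ContDiffOn ℝ (⊤ : ℕ∞) (fun z => g z i j)
      (Metric.ball (0 : EuclideanSpace ℂ (Fin n)) 1)) ∧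
  (∀ z ∈ Metric.ball (0 : EuclideanSpace ℂ (Fin n)) 1, (g z).IsHermitian) ∧
  (∀ z ∈ Metric.ball (0 : EuclideanSpace ℂ (Fin n)) 1, ∀ v : Fin n → ℂ,
      σ⁻¹ * (star v ⬝ᵥ v).re ≤ (star v ⬝ᵥ (g z).mulVec v).re ∧
      (star v ⬝ᵥ (g z).mulVec v).re ≤ σ * (star v ⬝ᵥ v).re) ∧
  (∀ i j : Fin n, ContinuousOn (fun z => H z i j)
      (Metric.ball (0 : EuclideanSpace ℂ (Fin n)) 1)) ∧
  (∀ z ∈ Metric.ball (0 : EuclideanSpace ℂ (Fin n)) 1, ∀ i j : Fin n,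
      |c| + ‖H z i j‖ ≤ Λ) ∧
  (∀ i j : Fin n, ∀ z ∈ Metric.ball (0 : EuclideanSpace ℂ (Fin n)) 1,
      ∀ y ∈ Metric.ball (0 : EuclideanSpace ℂ (Fin n)) 1,
      ‖g z i j - g y i j‖ ≤ M * ‖z - y‖ ^ α) ∧
  (∀ z ∈ Metric.ball (0 : EuclideanSpace ℂ (Fin n)) 1, ∀ i j : Fin n,
      (∑ k : Fin n, ∑ l : Fin n,
        ((g z)⁻¹ l k) * wirt n k (fun w => wirtBar n l (fun w' => g w' i j) w) z)
      - (∑ k : Fin n, ∑ m : Fin n, ∑ p : Fin n, ∑ l : Fin n,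
        ((g z)⁻¹ m k) * ((g z)⁻¹ l p) *
          wirt n p (fun w => g w i m) z * wirtBar n l (fun w => g w k j) z)
      = (c : ℂ) * g z i j + H z i j)

open scoped ComplexOrder in
/-- A Hermitian matrix with nonnegative quadratic form is a sum of rank-one forms. -/
theorem Matrix.IsHermitian.exists_eq_sum_star_mul {n : ℕ} {Q : Matrix (Fin n) (Fin n) ℂ}
    (hQ : Q.IsHermitian) (hpos : ∀ v : Fin n → ℂ, 0 ≤ (star v ⬝ᵥ Q.mulVec v).re) :
    ∃ (m : ℕ) (v : Fin m → EuclideanSpace ℂ (Fin n)),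
      ∀ l k, Q l k = ∑ s, star (v s l) * v s k := by
  have hps : Q.PosSemidef := by
    refine Matrix.PosSemidef.of_dotProduct_mulVec_nonneg hQ fun x => ?_
    rw [Complex.nonneg_iff]
    refine ⟨hpos x, ?_⟩
    have h : star (star x ⬝ᵥ Q.mulVec x) = star x ⬝ᵥ Q.mulVec x := by
      conv_lhs => rw [Matrix.star_dotProduct, star_star, Matrix.star_mulVec, hQ.eq,
        ← Matrix.dotProduct_mulVec]
    exact (Complex.conj_eq_iff_im.1 h).symm
  obtain ⟨m, a, ha⟩ := Matrix.posSemidef_iff_eq_sum_vecMulVec.1 hps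
  refine ⟨m, fun s => WithLp.toLp 2 (star (a s)), fun l k => ?_⟩
  rw [ha, Matrix.sum_apply]
  simp [Matrix.vecMulVec_apply]

/-- Four times the coefficients `∂_k ∂_{l̄}` of a real bilinear form on `ℂⁿ`. -/
noncomputable def leviCoeff {n : ℕ}
    (H : EuclideanSpace ℂ (Fin n) →L[ℝ] EuclideanSpace ℂ (Fin n) →L[ℝ] ℂ) (k l : Fin n) : ℂ :=
  H (EuclideanSpace.single k 1) (EuclideanSpace.single l 1) +
    H (EuclideanSpace.single k Complex.I) (EuclideanSpace.single l Complex.I) +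
    Complex.I * (H (EuclideanSpace.single k 1) (EuclideanSpace.single l Complex.I) -
      H (EuclideanSpace.single k Complex.I) (EuclideanSpace.single l 1))

/-- The trace of the Levi form of `H` against the matrix `Q`. -/
noncomputable def leviTrace {n : ℕ}
    (H : EuclideanSpace ℂ (Fin n) →L[ℝ] EuclideanSpace ℂ (Fin n) →L[ℝ] ℂ)
    (Q : Matrix (Fin n) (Fin n) ℂ) : ℂ :=
  ∑ k, ∑ l, Q l k * leviCoeff H k l

theorem sum_sum_eq_of_symmetrization_eq {n : ℕ} {f g : Fin n → Fin n → ℂ}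
    (h : ∀ k l, f k l + f l k = g k l + g l k) : ∑ k, ∑ l, f k l = ∑ k, ∑ l, g k l := by
  have hf : ∑ k, ∑ l, f k l + ∑ k, ∑ l, f k l = ∑ k, ∑ l, g k l + ∑ k, ∑ l, g k l := by
    conv_lhs => arg 2; rw [Finset.sum_comm]
    conv_rhs => arg 2; rw [Finset.sum_comm]
    simp only [← Finset.sum_add_distrib, h]
  have h2 : (2 : ℂ) ≠ 0 := two_ne_zero
  exact mul_left_cancel₀ h2 (by rw [two_mul, two_mul, hf])

theorem EuclideanSpace.eq_sum_real_basis {n : ℕ} (v : EuclideanSpace ℂ (Fin n)) :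
    v = ∑ k, ((v k).re • EuclideanSpace.single k (1 : ℂ) +
      (v k).im • EuclideanSpace.single k Complex.I) := by
  ext j
  simp [Finset.sum_add_distrib, Pi.single_apply]

theorem EuclideanSpace.I_smul_eq_sum_real_basis {n : ℕ} (v : EuclideanSpace ℂ (Fin n)) :
    Complex.I • v = ∑ k, ((v k).re • EuclideanSpace.single k Complex.I +
      (-(v k).im) • EuclideanSpace.single k (1 : ℂ)) := by
  rw [EuclideanSpace.eq_sum_real_basis (Complex.I • v)]
  refine Finset.sum_congr rfl fun k _ => ?_
  simp [add_comm]

theorem levi_form_eq {n : ℕ}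
    {H : EuclideanSpace ℂ (Fin n) →L[ℝ] EuclideanSpace ℂ (Fin n) →L[ℝ] ℂ}
    (hH : ∀ v w, H v w = H w v) (v : EuclideanSpace ℂ (Fin n)) :
    H v v + H (Complex.I • v) (Complex.I • v) =
      ∑ k, ∑ l, star (v l) * v k * leviCoeff H k l := by
  have h1 : H v v = ∑ k, ∑ l, H ((v k).re • EuclideanSpace.single k (1 : ℂ) +
      (v k).im • EuclideanSpace.single k Complex.I)
      ((v l).re • EuclideanSpace.single l (1 : ℂ) +
      (v l).im • EuclideanSpace.single l Complex.I) := by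
    conv_lhs => rw [EuclideanSpace.eq_sum_real_basis v]
    simp only [map_sum, _root_.sum_apply]
    rw [Finset.sum_comm]
  have h2 : H (Complex.I • v) (Complex.I • v) =
      ∑ k, ∑ l, H ((v k).re • EuclideanSpace.single k Complex.I +
      (-(v k).im) • EuclideanSpace.single k (1 : ℂ))
      ((v l).re • EuclideanSpace.single l Complex.I +
      (-(v l).im) • EuclideanSpace.single l (1 : ℂ)) := by
    rw [EuclideanSpace.I_smul_eq_sum_real_basis v]
    simp only [map_sum, _root_.sum_apply]
    rw [Finset.sum_comm]
  rw [h1, h2, ← Finset.sum_add_distrib]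
  simp only [← Finset.sum_add_distrib]
  refine sum_sum_eq_of_symmetrization_eq fun k l => ?_
  simp only [map_add, map_smul, _root_.add_apply, _root_.smul_apply,
    leviCoeff, Complex.real_smul, Complex.ofReal_neg]
  rw [hH (EuclideanSpace.single l 1) (EuclideanSpace.single k 1),
    hH (EuclideanSpace.single l Complex.I) (EuclideanSpace.single k Complex.I),
    hH (EuclideanSpace.single l 1) (EuclideanSpace.single k Complex.I),
    hH (EuclideanSpace.single l Complex.I) (EuclideanSpace.single k 1)]
  have e1 : ∀ z : ℂ, z = z.re + z.im * Complex.I := fun z => (Complex.re_add_im z).symm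
  have e2 : ∀ z : ℂ, star z = z.re - z.im * Complex.I := fun z => by
    apply Complex.ext <;> simp
  rw [e2 (v l), e2 (v k)]
  conv_rhs => rw [e1 (v l), e1 (v k)]
  simp only [Complex.add_re, Complex.add_im, Complex.ofReal_re, Complex.ofReal_im, Complex.mul_re,
    Complex.mul_im, Complex.I_re, Complex.I_im, mul_zero, mul_one, sub_zero, add_zero,
    zero_add]
  linear_combination 2 * (((v l).re * (v k).im - (v k).re * (v l).im) *
    (H (EuclideanSpace.single k Complex.I) (EuclideanSpace.single l 1) -
      H (EuclideanSpace.single k 1) (EuclideanSpace.single l Complex.I)) +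
    (v k).im * (v l).im * (H (EuclideanSpace.single k 1) (EuclideanSpace.single l 1) +
      H (EuclideanSpace.single k Complex.I) (EuclideanSpace.single l Complex.I))) * Complex.I_sq

theorem leviTrace_add {n : ℕ}
    (H : EuclideanSpace ℂ (Fin n) →L[ℝ] EuclideanSpace ℂ (Fin n) →L[ℝ] ℂ)
    (Q R : Matrix (Fin n) (Fin n) ℂ) : leviTrace H (Q + R) = leviTrace H Q + leviTrace H R := by
  simp only [leviTrace, Matrix.add_apply, add_mul, Finset.sum_add_distrib]

theorem leviTrace_smul {n : ℕ}
    (H : EuclideanSpace ℂ (Fin n) →L[ℝ] EuclideanSpace ℂ (Fin n) →L[ℝ] ℂ)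
    (c : ℂ) (Q : Matrix (Fin n) (Fin n) ℂ) : leviTrace H (c • Q) = c * leviTrace H Q := by
  simp only [leviTrace, Matrix.smul_apply, smul_eq_mul, mul_assoc, Finset.mul_sum]

theorem leviTrace_one {n : ℕ}
    (H : EuclideanSpace ℂ (Fin n) →L[ℝ] EuclideanSpace ℂ (Fin n) →L[ℝ] ℂ)
    (hH : ∀ v w, H v w = H w v) : leviTrace H 1 =
      ∑ k, (H (EuclideanSpace.single k 1) (EuclideanSpace.single k 1) +
        H (EuclideanSpace.single k Complex.I) (EuclideanSpace.single k Complex.I)) := by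
  simp only [leviTrace, Matrix.one_apply, ite_mul, one_mul, zero_mul, Finset.sum_ite_eq',
    Finset.mem_univ, if_true, leviCoeff]
  refine Finset.sum_congr rfl fun k _ => ?_
  rw [hH (EuclideanSpace.single k 1) (EuclideanSpace.single k Complex.I)]
  simp

theorem leviTrace_eq_sum {n m : ℕ}
    {H : EuclideanSpace ℂ (Fin n) →L[ℝ] EuclideanSpace ℂ (Fin n) →L[ℝ] ℂ}
    (hH : ∀ v w, H v w = H w v) {Q : Matrix (Fin n) (Fin n) ℂ}
    {v : Fin m → EuclideanSpace ℂ (Fin n)} (hv : ∀ l k, Q l k = ∑ s, star (v s l) * v s k) :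
    leviTrace H Q = ∑ s, (H (v s) (v s) + H (Complex.I • v s) (Complex.I • v s)) := by
  simp only [levi_form_eq hH, leviTrace, hv, Finset.sum_mul]
  rw [Finset.sum_comm]
  conv_rhs => rw [Finset.sum_comm]
  conv_lhs => rw [Finset.sum_comm]
  refine Finset.sum_congr rfl fun k _ => ?_
  rw [Finset.sum_comm]

theorem trace_re_eq_sum_norm_sq {n m : ℕ} {Q : Matrix (Fin n) (Fin n) ℂ}
    {v : Fin m → EuclideanSpace ℂ (Fin n)} (hv : ∀ l k, Q l k = ∑ s, star (v s l) * v s k) :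
    Q.trace.re = ∑ s, ‖v s‖ ^ 2 := by
  simp only [Matrix.trace, Matrix.diag, hv, EuclideanSpace.norm_sq_eq]
  rw [Finset.sum_comm, Complex.re_sum]
  refine Finset.sum_congr rfl fun s _ => ?_
  rw [Complex.re_sum]
  refine Finset.sum_congr rfl fun k _ => ?_
  rw [← Complex.normSq_eq_norm_sq, Complex.normSq_apply]
  simp

/-- The real inner product of `ℂⁿ` in coordinates. -/
noncomputable def reInner {n : ℕ} (e v : EuclideanSpace ℂ (Fin n)) : ℝ :=
  ∑ k, ((e k).re * (v k).re + (e k).im * (v k).im)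

theorem reInner_smul_right {n : ℕ} (e v : EuclideanSpace ℂ (Fin n)) (c : ℝ) :
    reInner e (c • v) = c * reInner e v := by
  simp only [reInner, Finset.mul_sum, PiLp.smul_apply, Complex.smul_re, Complex.smul_im,
    smul_eq_mul]
  exact Finset.sum_congr rfl fun k _ => by ring

theorem reInner_smul_left {n : ℕ} (e v : EuclideanSpace ℂ (Fin n)) (c : ℝ) :
    reInner (c • e) v = c * reInner e v := by
  simp only [reInner, Finset.mul_sum, PiLp.smul_apply, Complex.smul_re, Complex.smul_im,
    smul_eq_mul]
  exact Finset.sum_congr rfl fun k _ => by ring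

theorem reInner_self {n : ℕ} (e : EuclideanSpace ℂ (Fin n)) : reInner e e = ‖e‖ ^ 2 := by
  rw [EuclideanSpace.norm_sq_eq, reInner]
  refine Finset.sum_congr rfl fun k _ => ?_
  rw [← Complex.normSq_eq_norm_sq, Complex.normSq_apply]

theorem norm_add_smul_sq {n : ℕ} (p d : EuclideanSpace ℂ (Fin n)) (t : ℝ) :
    ‖p + t • d‖ ^ 2 = ‖p‖ ^ 2 + 2 * t * reInner p d + t ^ 2 * ‖d‖ ^ 2 := by
  simp only [← reInner_self, reInner, Finset.mul_sum, ← Finset.sum_add_distrib, PiLp.add_apply,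
    PiLp.smul_apply, Complex.add_re, Complex.add_im, Complex.smul_re, Complex.smul_im, smul_eq_mul]
  exact Finset.sum_congr rfl fun k _ => by ring

/-- Reflecting the standard real basis in the hyperplane orthogonal to `e` does not change the
trace of a symmetric bilinear form. -/
theorem sum_reflection_eq {n : ℕ}
    {H : EuclideanSpace ℂ (Fin n) →L[ℝ] EuclideanSpace ℂ (Fin n) →L[ℝ] ℂ}
    (hH : ∀ v w, H v w = H w v) {e : EuclideanSpace ℂ (Fin n)} (he : ‖e‖ = 1) :
    ∑ k, (H (EuclideanSpace.single k 1 - (2 * (e k).re) • e)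
          (EuclideanSpace.single k 1 - (2 * (e k).re) • e) +
        H (EuclideanSpace.single k Complex.I - (2 * (e k).im) • e)
          (EuclideanSpace.single k Complex.I - (2 * (e k).im) • e)) =
      ∑ k, (H (EuclideanSpace.single k 1) (EuclideanSpace.single k 1) +
        H (EuclideanSpace.single k Complex.I) (EuclideanSpace.single k Complex.I)) := by
  have h1 : H e e = ∑ k, ((e k).re * H (EuclideanSpace.single k 1) e +
      (e k).im * H (EuclideanSpace.single k Complex.I) e) := by
    conv_lhs => arg 1; rw [EuclideanSpace.eq_sum_real_basis e]
    simp only [map_sum, _root_.sum_apply, map_add, map_smul, _root_.add_apply,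
      _root_.smul_apply, Complex.real_smul]
  have h2 : ∑ k, (((e k).re : ℂ) ^ 2 + ((e k).im : ℂ) ^ 2) = 1 := by
    have := reInner_self e
    rw [he, reInner, one_pow] at this
    exact_mod_cast (by simpa [sq] using this :
      ∑ k, ((e k).re ^ 2 + (e k).im ^ 2) = (1 : ℝ))
  have h3 : ∀ (v : EuclideanSpace ℂ (Fin n)) (r : ℝ), H (v - (2 * r) • e) (v - (2 * r) • e) =
      H v v - 4 * (r * H v e) + 4 * (r ^ 2 * H e e) := by
    intro v r
    simp only [map_sub, map_smul, _root_.sub_apply, _root_.smul_apply, Complex.real_smul]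
    rw [hH e v]
    push_cast
    ring
  simp only [h3]
  have h4 : ∑ k, (((e k).re : ℂ) ^ 2 + ((e k).im : ℂ) ^ 2) * H e e = H e e := by
    rw [← Finset.sum_mul, h2, one_mul]
  rw [← sub_eq_zero, ← Finset.sum_sub_distrib]
  have h5 : 4 * (∑ k, (((e k).re : ℂ) ^ 2 + ((e k).im : ℂ) ^ 2) * H e e) -
    4 * ∑ k, ((e k).re * H (EuclideanSpace.single k 1) e +
      (e k).im * H (EuclideanSpace.single k Complex.I) e) = 0 := by
    rw [h4, ← h1, sub_self]
  rw [← h5, Finset.mul_sum, Finset.mul_sum, ← Finset.sum_sub_distrib]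
  exact Finset.sum_congr rfl fun k _ => by ring

/-- The squared norm of a real-linear form on `ℂⁿ`, in coordinates. -/
noncomputable def gradSq {n : ℕ} (D : EuclideanSpace ℂ (Fin n) →L[ℝ] ℂ) : ℝ :=
  ∑ k, (‖D (EuclideanSpace.single k 1)‖ ^ 2 + ‖D (EuclideanSpace.single k Complex.I)‖ ^ 2)

theorem gradSq_nonneg {n : ℕ} (D : EuclideanSpace ℂ (Fin n) →L[ℝ] ℂ) : 0 ≤ gradSq D :=
  Finset.sum_nonneg fun _ _ => by positivity

/-- Tracing a nonpositive second variation on the doubled space `ℂⁿ × ℂⁿ` against the coupling of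
`P` and `Q` that reflects in the direction `e` and is synchronous otherwise. -/
theorem coupling_trace_le {n : ℕ} {ι : Type*} [Fintype ι]
    {HX HY : EuclideanSpace ℂ (Fin n) →L[ℝ] EuclideanSpace ℂ (Fin n) →L[ℝ] ℂ}
    (hX : ∀ v w, HX v w = HX w v) (hY : ∀ v w, HY v w = HY w v)
    {DX DY : ι → EuclideanSpace ℂ (Fin n) →L[ℝ] ℂ} {e : EuclideanSpace ℂ (Fin n)} (he : ‖e‖ = 1)
    {N A L γ δ ε : ℝ} (hN : 0 ≤ N) (hA : 0 ≤ A) (hγ : γ ≤ 2) (hε : 0 ≤ ε) (hεδ : ε ≤ δ)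
    {P Q : Matrix (Fin n) (Fin n) ℂ} (hP : P.IsHermitian) (hQ : Q.IsHermitian)
    (hPδ : ∀ v : Fin n → ℂ, 0 ≤ (star v ⬝ᵥ (P - (δ : ℂ) • 1).mulVec v).re)
    (hQP : ∀ v : Fin n → ℂ, 0 ≤ (star v ⬝ᵥ (Q - P + ((ε / 2 : ℝ) : ℂ) • 1).mulVec v).re)
    (htr : (Q - P).trace.re ≤ n * (ε / 2))
    (hF : ∀ v w, (HX v v).re - (HY w w).re + 2 * N * ∑ i, ‖DX i v - DY i w‖ ^ 2 -
      A * (‖v - w‖ ^ 2 - (2 - γ) * reInner e (v - w) ^ 2) - 2 * L * ‖v‖ ^ 2 ≤ 0) :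
    (leviTrace HX P).re - (leviTrace HY Q).re +
      N * ε * ∑ i, (gradSq (DX i) + gradSq (DY i)) +
      A * (4 * (1 - γ) * (δ - ε) - 5 * n * ε) - 4 * L * P.trace.re ≤ 0 := by
  have hsm : ∀ c : ℝ, ((c : ℂ) • (1 : Matrix (Fin n) (Fin n) ℂ)).IsHermitian := fun c => by
    simp [Matrix.IsHermitian, Matrix.conjTranspose_smul]
  obtain ⟨m₁, v, hv⟩ := (hP.sub (hsm δ)).exists_eq_sum_star_mul hPδ
  obtain ⟨m₂, u, hu⟩ := ((hQ.sub hP).add (hsm (ε / 2))).exists_eq_sum_star_mul hQP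
  have hnI : ∀ w : EuclideanSpace ℂ (Fin n), ‖Complex.I • w‖ = ‖w‖ := fun w => by
    rw [norm_smul, Complex.norm_I, one_mul]
  have hnn : ∀ v w, 0 ≤ 2 * N * ∑ i, ‖DX i v - DY i w‖ ^ 2 := fun v w => by positivity
  have htr1 : ((1 : Matrix (Fin n) (Fin n) ℂ)).trace.re = n := by simp
  have hre0 : reInner e 0 = 0 := by simp [reInner]
  -- synchronous part
  have s1 : (leviTrace HX (P - (δ : ℂ) • 1)).re - (leviTrace HY (P - (δ : ℂ) • 1)).re -
      4 * L * (P - (δ : ℂ) • 1).trace.re ≤ 0 := by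
    rw [leviTrace_eq_sum hX hv, leviTrace_eq_sum hY hv, trace_re_eq_sum_norm_sq hv,
      Complex.re_sum, Complex.re_sum, Finset.mul_sum, ← Finset.sum_sub_distrib,
      ← Finset.sum_sub_distrib]
    refine Finset.sum_nonpos fun s _ => ?_
    have a1 := hF (v s) (v s)
    have a2 := hF (Complex.I • v s) (Complex.I • v s)
    have b1 := hnn (v s) (v s)
    have b2 := hnn (Complex.I • v s) (Complex.I • v s)
    simp only [sub_self, norm_zero, hre0, hnI] at a1 a2
    rw [Complex.add_re, Complex.add_re]
    linarith
  -- reflected part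
  have s2 : (leviTrace HX 1).re - (leviTrace HY 1).re + A * (4 * (1 - γ)) - 4 * L * n ≤ 0 := by
    rw [leviTrace_one HX hX, leviTrace_one HY hY, ← sum_reflection_eq hY he]
    have h2 : ∑ k, ((e k).re ^ 2 + (e k).im ^ 2) = (1 : ℝ) := by
      have := reInner_self e
      rw [he, reInner, one_pow] at this
      simpa [sq] using this
    have h3 : (n : ℝ) = ∑ k : Fin n, (1 : ℝ) := by simp
    have h4 : A * (4 * (1 - γ)) =
        ∑ k, A * (4 * (1 - γ)) * ((e k).re ^ 2 + (e k).im ^ 2) := by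
      rw [← Finset.mul_sum, h2, mul_one]
    rw [h4, h3, Complex.re_sum, Complex.re_sum, Finset.mul_sum, ← Finset.sum_sub_distrib,
      ← Finset.sum_add_distrib, ← Finset.sum_sub_distrib]
    refine Finset.sum_nonpos fun k _ => ?_
    have key : ∀ (r : ℝ) (b : EuclideanSpace ℂ (Fin n)), ‖b‖ = 1 →
        (HX b b).re - (HY (b - (2 * r) • e) (b - (2 * r) • e)).re + A * (4 * (1 - γ)) * r ^ 2 -
          2 * L ≤ 0 := by
      intro r b hb
      have a1 := hF b (b - (2 * r) • e)
      have b1 := hnn b (b - (2 * r) • e)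
      rw [sub_sub_cancel, norm_smul, he, reInner_smul_right, reInner_self, he, hb, mul_one,
        Real.norm_eq_abs, sq_abs] at a1
      nlinarith [a1, b1]
    have k1 := key (e k).re (EuclideanSpace.single k 1) (by simp)
    have k2 := key (e k).im (EuclideanSpace.single k Complex.I) (by simp)
    rw [Complex.add_re, Complex.add_re]
    linarith
  -- uncoupled parts
  have hφ : ∀ d : EuclideanSpace ℂ (Fin n),
      A * (‖d‖ ^ 2 - (2 - γ) * reInner e d ^ 2) ≤ A * ‖d‖ ^ 2 := fun d =>
    mul_le_mul_of_nonneg_left (by nlinarith [mul_nonneg (sub_nonneg.2 hγ) (sq_nonneg (reInner e d))]) hA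
  have hsum : ∀ D : ι → EuclideanSpace ℂ (Fin n) →L[ℝ] ℂ, 2 * N * ∑ i, gradSq (D i) =
      ∑ k, (2 * N * ∑ i, ‖D i (EuclideanSpace.single k 1)‖ ^ 2 +
        2 * N * ∑ i, ‖D i (EuclideanSpace.single k Complex.I)‖ ^ 2) := fun D => by
    simp only [gradSq]
    rw [Finset.sum_comm, Finset.mul_sum]
    simp only [← mul_add, ← Finset.sum_add_distrib]
  have h3 : (n : ℝ) = ∑ k : Fin n, (1 : ℝ) := by simp
  have s3 : (leviTrace HX 1).re + 2 * N * ∑ i, gradSq (DX i) - (2 * A + 4 * L) * n ≤ 0 := by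
    rw [leviTrace_one HX hX, hsum, Complex.re_sum, h3, Finset.mul_sum, ← Finset.sum_add_distrib,
      ← Finset.sum_sub_distrib]
    refine Finset.sum_nonpos fun k _ => ?_
    have a1 := hF (EuclideanSpace.single k 1) 0
    have a2 := hF (EuclideanSpace.single k Complex.I) 0
    have b1 := hφ (EuclideanSpace.single k 1)
    have b2 := hφ (EuclideanSpace.single k Complex.I)
    simp only [map_zero, sub_zero, Complex.zero_re, PiLp.norm_single, norm_one,
      Complex.norm_I, one_pow, mul_one] at a1 a2 b1 b2
    rw [Complex.add_re]
    linarith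
  have s4 : -(leviTrace HY 1).re + 2 * N * ∑ i, gradSq (DY i) - (2 * A) * n ≤ 0 := by
    rw [leviTrace_one HY hY, hsum, Complex.re_sum, h3, Finset.mul_sum, ← Finset.sum_neg_distrib,
      ← Finset.sum_add_distrib, ← Finset.sum_sub_distrib]
    refine Finset.sum_nonpos fun k _ => ?_
    have a1 := hF 0 (EuclideanSpace.single k 1)
    have a2 := hF 0 (EuclideanSpace.single k Complex.I)
    have b1 := hφ (-EuclideanSpace.single k 1)
    have b2 := hφ (-EuclideanSpace.single k Complex.I)
    simp only [map_zero, zero_sub, Complex.zero_re, PiLp.norm_single, norm_one, norm_neg,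
      Complex.norm_I, one_pow, mul_one, norm_zero] at a1 a2 b1 b2
    rw [Complex.add_re]
    linarith
  have s5 : -(leviTrace HY (Q - P + ((ε / 2 : ℝ) : ℂ) • 1)).re -
      2 * A * (Q - P + ((ε / 2 : ℝ) : ℂ) • 1).trace.re ≤ 0 := by
    rw [leviTrace_eq_sum hY hu, trace_re_eq_sum_norm_sq hu, Complex.re_sum, Finset.mul_sum,
      ← Finset.sum_neg_distrib, ← Finset.sum_sub_distrib]
    refine Finset.sum_nonpos fun s _ => ?_
    have a1 := hF 0 (u s)
    have a2 := hF 0 (Complex.I • u s)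
    have b1 := hφ (-u s)
    have b2 := hφ (-(Complex.I • u s))
    have c1 := hnn 0 (u s)
    have c2 := hnn 0 (Complex.I • u s)
    simp only [map_zero, zero_sub, Complex.zero_re, norm_neg, hnI, norm_zero] at a1 a2 b1 b2 c1 c2
    rw [Complex.add_re]
    linarith
  have t1 : (P - (δ : ℂ) • 1).trace.re = P.trace.re - δ * n := by
    rw [Matrix.trace_sub, Matrix.trace_smul, Complex.sub_re, smul_eq_mul, Complex.re_ofReal_mul,
      htr1]
  have t2 : (Q - P + ((ε / 2 : ℝ) : ℂ) • 1).trace.re = (Q - P).trace.re + ε / 2 * n := by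
    rw [Matrix.trace_add, Matrix.trace_smul, Complex.add_re, smul_eq_mul, Complex.re_ofReal_mul,
      htr1]
  have l1 : ∀ H : EuclideanSpace ℂ (Fin n) →L[ℝ] EuclideanSpace ℂ (Fin n) →L[ℝ] ℂ,
      (leviTrace H (P - (δ : ℂ) • 1)).re = (leviTrace H P).re - δ * (leviTrace H 1).re := by
    intro H
    have := leviTrace_add H (P - (δ : ℂ) • 1) ((δ : ℂ) • 1)
    rw [sub_add_cancel, leviTrace_smul] at this
    rw [this, Complex.add_re, Complex.re_ofReal_mul]
    ring
  have l2 : (leviTrace HY (Q - P + ((ε / 2 : ℝ) : ℂ) • 1)).re =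
      (leviTrace HY Q).re - (leviTrace HY P).re + ε / 2 * (leviTrace HY 1).re := by
    have := leviTrace_add HY (Q - P) P
    rw [sub_add_cancel] at this
    rw [this, leviTrace_add, leviTrace_smul, Complex.add_re, Complex.add_re, Complex.re_ofReal_mul]
    ring
  rw [t1, l1, l1] at s1
  rw [t2, l2] at s5
  have w2 := mul_nonpos_of_nonneg_of_nonpos (sub_nonneg.2 hεδ) s2
  have w3 := mul_nonpos_of_nonneg_of_nonpos hε s3
  have w4 := mul_nonpos_of_nonneg_of_nonpos (by linarith : (0 : ℝ) ≤ ε / 2) s4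
  have w5 := mul_le_mul_of_nonneg_left htr hA
  rw [Finset.sum_add_distrib]
  have w6 : 0 ≤ N * ε * ∑ i, gradSq (DX i) :=
    mul_nonneg (mul_nonneg hN hε) (Finset.sum_nonneg fun i _ => gradSq_nonneg _)
  linarith

open Filter Topology in
theorem IsLocalMax.second_deriv_nonpos {ψ ψ' : ℝ → ℝ} {a c : ℝ} (hmax : IsLocalMax ψ a)
    (h1 : ∀ᶠ t in 𝓝 a, HasDerivAt ψ (ψ' t) t) (h2 : HasDerivAt ψ' c a) : c ≤ 0 := by
  by_contra hc
  push Not at hc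
  have e1 : deriv ψ =ᶠ[𝓝 a] ψ' := h1.mono fun t ht => ht.deriv
  have hd : deriv (deriv ψ) a = c := by rw [e1.deriv_eq, h2.deriv]
  have hmin := isLocalMin_of_deriv_deriv_pos (hd ▸ hc) hmax.deriv_eq_zero
    h1.self_of_nhds.continuousAt
  have hconst : ψ =ᶠ[𝓝 a] fun _ => ψ a := by
    filter_upwards [hmax, hmin] with t h3 h4 using le_antisymm h3 h4
  have : deriv (deriv ψ) a = 0 := by
    have e2 : deriv ψ =ᶠ[𝓝 a] fun _ => 0 := by
      have := hconst.deriv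
      simpa using this
    rw [e2.deriv_eq, deriv_const]
  linarith

open Filter Topology in
theorem ContDiffAt.eventually_hasDerivAt_line {E F : Type*} [NormedAddCommGroup E]
    [NormedSpace ℝ E] [NormedAddCommGroup F] [NormedSpace ℝ F] {u : E → F} {x : E}
    (hu : ContDiffAt ℝ 2 u x) (v : E) :
    ∀ᶠ t : ℝ in 𝓝 0, HasDerivAt (fun t : ℝ => u (x + t • v)) (fderiv ℝ u (x + t • v) v) t := by
  have hl : Tendsto (fun t : ℝ => x + t • v) (𝓝 0) (𝓝 x) := by
    have : Continuous fun t : ℝ => x + t • v := by fun_prop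
    simpa using this.tendsto 0
  have h1 : ∀ᶠ z in 𝓝 x, DifferentiableAt ℝ u z := by
    filter_upwards [hu.eventually (by simp)] with z hz using hz.differentiableAt (by simp)
  filter_upwards [hl.eventually h1] with t ht
  have h2 : HasDerivAt (fun t : ℝ => x + t • v) v t := by
    simpa using ((hasDerivAt_id t).smul_const v).const_add x
  exact ht.hasFDerivAt.comp_hasDerivAt t h2

theorem ContDiffAt.hasDerivAt_fderiv_line {E F : Type*} [NormedAddCommGroup E]
    [NormedSpace ℝ E] [NormedAddCommGroup F] [NormedSpace ℝ F] {u : E → F} {x : E}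
    (hu : ContDiffAt ℝ 2 u x) (v : E) :
    HasDerivAt (fun t : ℝ => fderiv ℝ u (x + t • v) v) (fderiv ℝ (fderiv ℝ u) x v v) 0 := by
  have h1 : DifferentiableAt ℝ (fderiv ℝ u) x :=
    (hu.fderiv_right (m := 1) (by norm_num)).differentiableAt (by simp)
  have h2 : HasDerivAt (fun t : ℝ => x + t • v) v 0 := by
    simpa using ((hasDerivAt_id (0 : ℝ)).smul_const v).const_add x
  have h3 : HasFDerivAt (fderiv ℝ u) (fderiv ℝ (fderiv ℝ u) x) (x + (0 : ℝ) • v) := by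
    simpa using h1.hasFDerivAt
  have h4 := h3.comp_hasDerivAt (0 : ℝ) h2
  exact (ContinuousLinearMap.apply ℝ F v).hasFDerivAt.comp_hasDerivAt (0 : ℝ) h4

/-- The doubling-of-variables functional. -/
noncomputable def doublingFun {n : ℕ} {ι : Type*} [Fintype ι]
    (g : ι → EuclideanSpace ℂ (Fin n) → ℂ) (θ : ι → ℂ) (N K L γ : ℝ)
    (x₀ : EuclideanSpace ℂ (Fin n))
    (q : EuclideanSpace ℂ (Fin n) × EuclideanSpace ℂ (Fin n)) : ℝ :=
  (∑ i, θ i * (g i q.1 - g i q.2)).re + N * ∑ i, ‖g i q.1 - g i q.2‖ ^ 2 -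
    K * ‖q.1 - q.2‖ ^ γ - L * ‖q.1 - x₀‖ ^ 2

open Filter Topology in
theorem second_variation_nonpos {n : ℕ} {ι : Type*} [Fintype ι]
    {g : ι → EuclideanSpace ℂ (Fin n) → ℂ} {θ : ι → ℂ} {N K L γ : ℝ}
    {x₀ x y : EuclideanSpace ℂ (Fin n)} (hxy : x ≠ y)
    (hx : ∀ i, ContDiffAt ℝ 2 (g i) x) (hy : ∀ i, ContDiffAt ℝ 2 (g i) y)
    (hmax : IsLocalMax (doublingFun g θ N K L γ x₀) (x, y)) (v w : EuclideanSpace ℂ (Fin n)) :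
    ((∑ i, (θ i + 2 * N * star (g i x - g i y)) • fderiv ℝ (fderiv ℝ (g i)) x) v v).re -
      ((∑ i, (θ i + 2 * N * star (g i x - g i y)) • fderiv ℝ (fderiv ℝ (g i)) y) w w).re +
      2 * N * ∑ i, ‖fderiv ℝ (g i) x v - fderiv ℝ (g i) y w‖ ^ 2 -
      K * γ * ‖x - y‖ ^ (γ - 2) * (‖v - w‖ ^ 2 -
        (2 - γ) * reInner (‖x - y‖⁻¹ • (x - y)) (v - w) ^ 2) - 2 * L * ‖v‖ ^ 2 ≤ 0 := by
  set p := x - y with hp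
  set d := v - w with hd
  have hr : 0 < ‖p‖ := norm_pos_iff.2 (sub_ne_zero.2 hxy)
  set f : ι → ℝ → ℂ := fun i t => g i (x + t • v) - g i (y + t • w) with hf
  set f' : ι → ℝ → ℂ := fun i t => fderiv ℝ (g i) (x + t • v) v - fderiv ℝ (g i) (y + t • w) w
    with hf'
  set f'' : ι → ℂ := fun i => fderiv ℝ (fderiv ℝ (g i)) x v v - fderiv ℝ (fderiv ℝ (g i)) y w w
    with hf''
  set q : ℝ → ℝ := fun t => ‖p‖ ^ 2 + 2 * t * reInner p d + t ^ 2 * ‖d‖ ^ 2 with hq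
  set q' : ℝ → ℝ := fun t => 2 * reInner p d + 2 * t * ‖d‖ ^ 2 with hq'
  have hq1 : ∀ t, HasDerivAt q (q' t) t := fun t => by
    have := ((((hasDerivAt_id t).const_mul 2).mul_const (reInner p d)).const_add (‖p‖ ^ 2)).add
      (((hasDerivAt_id t).pow 2).mul_const (‖d‖ ^ 2))
    refine this.congr_deriv ?_
    simp [hq']
  have hq2 : HasDerivAt q' (2 * ‖d‖ ^ 2) 0 := by
    have := (((hasDerivAt_id (0 : ℝ)).const_mul 2).mul_const (‖d‖ ^ 2)).const_add (2 * reInner p d)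
    exact this.congr_deriv (by simp)
  have hq0 : q 0 = ‖p‖ ^ 2 := by simp [hq]
  have hqpos : ∀ᶠ t in 𝓝 (0 : ℝ), 0 < q t :=
    (hq1 0).continuousAt.eventually (lt_mem_nhds (by rw [hq0]; positivity))
  have hf1 : ∀ᶠ t in 𝓝 (0 : ℝ), ∀ i, HasDerivAt (f i) (f' i t) t := by
    refine eventually_all.2 fun i => ?_
    filter_upwards [(hx i).eventually_hasDerivAt_line v, (hy i).eventually_hasDerivAt_line w]
      with t h1 h2 using h1.sub h2
  have hf2 : ∀ i, HasDerivAt (f' i) (f'' i) 0 := fun i =>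
    ((hx i).hasDerivAt_fderiv_line v).sub ((hy i).hasDerivAt_fderiv_line w)
  set s : ℝ → ℝ := fun t => ‖x - x₀‖ ^ 2 + 2 * t * reInner (x - x₀) v + t ^ 2 * ‖v‖ ^ 2 with hs
  set s' : ℝ → ℝ := fun t => 2 * reInner (x - x₀) v + 2 * t * ‖v‖ ^ 2 with hs'
  have hs1 : ∀ t, HasDerivAt s (s' t) t := fun t => by
    have := ((((hasDerivAt_id t).const_mul 2).mul_const (reInner (x - x₀) v)).const_add
      (‖x - x₀‖ ^ 2)).add (((hasDerivAt_id t).pow 2).mul_const (‖v‖ ^ 2))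
    refine this.congr_deriv ?_
    simp [hs']
  have hs2 : HasDerivAt s' (2 * ‖v‖ ^ 2) 0 := by
    have := (((hasDerivAt_id (0 : ℝ)).const_mul 2).mul_const (‖v‖ ^ 2)).const_add
      (2 * reInner (x - x₀) v)
    exact this.congr_deriv (by simp)
  set ψ : ℝ → ℝ := fun t => (∑ i, θ i * f i t).re + N * ∑ i, ‖f i t‖ ^ 2 -
    K * q t ^ (γ / 2) - L * s t with hψ
  have hψeq : ψ = fun t : ℝ => doublingFun g θ N K L γ x₀ (x + t • v, y + t • w) := by
    funext t
    have h1 : x + t • v - (y + t • w) = p + t • d := by rw [hp, hd, smul_sub]; abel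
    have h2 : x + t • v - x₀ = x - x₀ + t • v := by abel
    have h3 : q t = ‖p + t • d‖ ^ 2 := (norm_add_smul_sq p d t).symm
    simp only [hψ, doublingFun, hf]
    rw [h1, h2, h3, norm_add_smul_sq (x - x₀), ← Real.rpow_natCast ‖p + t • d‖ 2,
      ← Real.rpow_mul (norm_nonneg _)]
    congr 4
    push_cast
    ring
  have hψmax : IsLocalMax ψ 0 := by
    rw [hψeq]
    have hc : Continuous fun t : ℝ => (x + t • v, y + t • w) := by fun_prop
    have ht : Tendsto (fun t : ℝ => (x + t • v, y + t • w)) (𝓝 0) (𝓝 (x, y)) := by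
      simpa using hc.tendsto 0
    have := ht.eventually hmax
    simpa [IsLocalMax, IsMaxFilter] using this
  have hψ1 : ∀ᶠ t in 𝓝 (0 : ℝ), HasDerivAt ψ ((∑ i, θ i * f' i t).re +
      N * ∑ i, 2 * inner ℝ (f i t) (f' i t) - K * (q' t * (γ / 2) * q t ^ (γ / 2 - 1)) -
      L * s' t) t := by
    filter_upwards [hf1, hqpos] with t h1 h2
    have a1 : HasDerivAt (fun t => (∑ i, θ i * f i t).re) (∑ i, θ i * f' i t).re t :=
      Complex.reCLM.hasFDerivAt.comp_hasDerivAt t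
        (HasDerivAt.fun_sum fun i _ => (h1 i).const_mul (θ i))
    exact ((a1.add ((HasDerivAt.fun_sum fun i _ => (h1 i).norm_sq).const_mul N)).sub
      (((hq1 t).rpow_const (Or.inl h2.ne')).const_mul K)).sub ((hs1 t).const_mul L)
  have hψ2 : HasDerivAt (fun t => (∑ i, θ i * f' i t).re +
      N * ∑ i, 2 * inner ℝ (f i t) (f' i t) - K * (q' t * (γ / 2) * q t ^ (γ / 2 - 1)) -
      L * s' t) ((∑ i, θ i * f'' i).re +
      N * ∑ i, 2 * (inner ℝ (f i 0) (f'' i) + inner ℝ (f' i 0) (f' i 0)) -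
      K * (2 * ‖d‖ ^ 2 * (γ / 2) * q 0 ^ (γ / 2 - 1) +
        q' 0 * (γ / 2) * (q' 0 * (γ / 2 - 1) * q 0 ^ (γ / 2 - 1 - 1))) -
      L * (2 * ‖v‖ ^ 2)) 0 := by
    have h1 := hf1.self_of_nhds
    have a1 : HasDerivAt (fun t => (∑ i, θ i * f' i t).re) (∑ i, θ i * f'' i).re 0 :=
      Complex.reCLM.hasFDerivAt.comp_hasDerivAt (0 : ℝ)
        (HasDerivAt.fun_sum fun i _ => (hf2 i).const_mul (θ i))
    exact ((a1.add ((HasDerivAt.fun_sum fun i _ =>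
      ((h1 i).inner ℝ (hf2 i)).const_mul 2).const_mul N)).sub
      (((hq2.mul_const (γ / 2)).mul ((hq1 0).rpow_const
        (Or.inl (by rw [hq0]; positivity)))).const_mul K)).sub (hs2.const_mul L)
  have hle := hψmax.second_deriv_nonpos hψ1 hψ2
  have hpow : ∀ b : ℝ, q 0 ^ b = ‖p‖ ^ (2 * b) := fun b => by
    rw [hq0, ← Real.rpow_natCast, ← Real.rpow_mul (norm_nonneg _)]; norm_num
  have e1 : q 0 ^ (γ / 2 - 1) = ‖p‖ ^ (γ - 2) := by rw [hpow]; congr 1; ring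
  have e2 : q 0 ^ (γ / 2 - 1 - 1) = ‖p‖ ^ (γ - 2) * ‖p‖⁻¹ ^ 2 := by
    rw [hpow, ← Real.rpow_natCast, Real.inv_rpow hr.le, ← Real.rpow_neg hr.le, ← Real.rpow_add hr]
    congr 1; push_cast; ring
  have e3 : ((∑ i, (θ i + 2 * N * star (g i x - g i y)) • fderiv ℝ (fderiv ℝ (g i)) x) v v).re -
      ((∑ i, (θ i + 2 * N * star (g i x - g i y)) • fderiv ℝ (fderiv ℝ (g i)) y) w w).re =
      (∑ i, θ i * f'' i).re + N * ∑ i, 2 * inner ℝ (f i 0) (f'' i) := by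
    rw [← Complex.sub_re]
    simp only [_root_.sum_apply, _root_.smul_apply, Complex.re_sum, Finset.mul_sum,
      ← Finset.sum_sub_distrib, ← Finset.sum_add_distrib]
    refine Finset.sum_congr rfl fun i _ => ?_
    simp only [hf, hf'', Complex.inner, zero_smul, add_zero, smul_eq_mul]
    simp only [Complex.sub_re, Complex.sub_im, Complex.mul_re, Complex.mul_im, Complex.add_re,
      Complex.add_im, Complex.ofReal_re, Complex.ofReal_im, Complex.star_def, Complex.conj_re,
      Complex.conj_im, Complex.re_ofNat, Complex.im_ofNat]
    ring
  have e4 : ∀ i, inner ℝ (f' i 0) (f' i 0) = ‖fderiv ℝ (g i) x v - fderiv ℝ (g i) y w‖ ^ 2 := by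
    intro i
    rw [real_inner_self_eq_norm_sq]
    simp [hf']
  have e5 : q' 0 = 2 * reInner p d := by simp [hq']
  rw [e3, reInner_smul_left]
  rw [e1, e2, e5] at hle
  simp only [e4, mul_add, Finset.sum_add_distrib] at hle
  have e6 : N * ∑ i, 2 * ‖fderiv ℝ (g i) x v - fderiv ℝ (g i) y w‖ ^ 2 =
      2 * N * ∑ i, ‖fderiv ℝ (g i) x v - fderiv ℝ (g i) y w‖ ^ 2 := by
    rw [← Finset.mul_sum]; ring
  rw [← e6]
  linarith

theorem re_star_dotProduct_self {n : ℕ} (v : Fin n → ℂ) :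
    (star v ⬝ᵥ v).re = ∑ i, ‖v i‖ ^ 2 := by
  rw [dotProduct, Complex.re_sum]
  refine Finset.sum_congr rfl fun i _ => ?_
  rw [← Complex.normSq_eq_norm_sq, Complex.normSq_apply]
  simp

theorem sq_sum_norm_le {n : ℕ} (v : Fin n → ℂ) :
    (∑ i, ‖v i‖) ^ 2 ≤ n * ∑ i, ‖v i‖ ^ 2 := by
  simpa using sq_sum_le_card_mul_sum_sq (s := Finset.univ) (f := fun i => ‖v i‖)

theorem abs_re_star_dotProduct_mulVec_le {n : ℕ} {A : Matrix (Fin n) (Fin n) ℂ} {d : ℝ}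
    (hd : 0 ≤ d) (hA : ∀ i j, ‖A i j‖ ≤ d) (v : Fin n → ℂ) :
    |(star v ⬝ᵥ A.mulVec v).re| ≤ n * d * ∑ i, ‖v i‖ ^ 2 := by
  calc |(star v ⬝ᵥ A.mulVec v).re| ≤ ‖star v ⬝ᵥ A.mulVec v‖ := Complex.abs_re_le_norm _
    _ ≤ ∑ i, ∑ j, ‖v i‖ * (d * ‖v j‖) := by
        rw [dotProduct]
        refine (norm_sum_le _ _).trans (Finset.sum_le_sum fun i _ => ?_)
        rw [norm_mul, Pi.star_apply, norm_star, Matrix.mulVec, dotProduct, ← Finset.mul_sum]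
        refine mul_le_mul_of_nonneg_left ((norm_sum_le _ _).trans
          (Finset.sum_le_sum fun j _ => ?_)) (norm_nonneg _)
        rw [norm_mul]
        exact mul_le_mul_of_nonneg_right (hA i j) (norm_nonneg _)
    _ = d * (∑ i, ‖v i‖) ^ 2 := by
        simp only [← Finset.mul_sum, ← Finset.sum_mul]; ring
    _ ≤ d * (n * ∑ i, ‖v i‖ ^ 2) := mul_le_mul_of_nonneg_left (sq_sum_norm_le v) hd
    _ = _ := by ring

theorem re_diag_le {n : ℕ} {A : Matrix (Fin n) (Fin n) ℂ} {s : ℝ}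
    (hle : ∀ v : Fin n → ℂ, (star v ⬝ᵥ A.mulVec v).re ≤ s * ∑ i, ‖v i‖ ^ 2) (a : Fin n) :
    (A a a).re ≤ s := by
  have h := hle (Pi.single a 1)
  have h1 : ∑ i, ‖(Pi.single a (1 : ℂ) : Fin n → ℂ) i‖ ^ 2 = 1 := by
    rw [Finset.sum_eq_single a (fun b _ hb => by simp [hb]) (by simp)]
    simp
  rw [h1, mul_one, ← Pi.single_star, star_one] at h
  simpa using h

theorem Matrix.IsHermitian.norm_apply_le {n : ℕ} {A : Matrix (Fin n) (Fin n) ℂ} {s : ℝ}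
    (hA : A.IsHermitian) (hpos : ∀ v : Fin n → ℂ, 0 ≤ (star v ⬝ᵥ A.mulVec v).re)
    (hle : ∀ v : Fin n → ℂ, (star v ⬝ᵥ A.mulVec v).re ≤ s * ∑ i, ‖v i‖ ^ 2) (a b : Fin n) :
    ‖A a b‖ ≤ s := by
  obtain ⟨m, v, hv⟩ := hA.exists_eq_sum_star_mul hpos
  have hd : ∀ c, (A c c).re = ∑ s, ‖v s c‖ ^ 2 := fun c => by
    rw [hv, Complex.re_sum]
    refine Finset.sum_congr rfl fun i _ => ?_
    rw [← Complex.normSq_eq_norm_sq, Complex.normSq_apply]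
    simp
  have h1 : ‖A a b‖ ≤ ∑ s, (‖v s a‖ ^ 2 + ‖v s b‖ ^ 2) / 2 := by
    rw [hv]
    refine (norm_sum_le _ _).trans (Finset.sum_le_sum fun i _ => ?_)
    rw [norm_mul, norm_star]
    nlinarith [sq_nonneg (‖v i a‖ - ‖v i b‖)]
  rw [← Finset.sum_div, Finset.sum_add_distrib, ← hd, ← hd] at h1
  linarith [re_diag_le hle a, re_diag_le hle b]

theorem Matrix.isUnit_det_of_form_pos {n : ℕ} {A : Matrix (Fin n) (Fin n) ℂ} {s : ℝ} (hs : 0 < s)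
    (hlow : ∀ v : Fin n → ℂ, s * ∑ i, ‖v i‖ ^ 2 ≤ (star v ⬝ᵥ A.mulVec v).re) :
    IsUnit A.det := by
  rw [← Matrix.isUnit_iff_isUnit_det, ← Matrix.mulVec_injective_iff_isUnit]
  refine (injective_iff_map_eq_zero A.mulVecLin).2 fun v hv => ?_
  have hv' : A.mulVec v = 0 := hv
  have h := hlow v
  rw [hv', dotProduct_zero, Complex.zero_re] at h
  have h1 : ∑ i, ‖v i‖ ^ 2 = 0 :=
    le_antisymm (by nlinarith) (Finset.sum_nonneg fun i _ => by positivity)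
  funext i
  have := (Finset.sum_eq_zero_iff_of_nonneg (fun i _ => by positivity)).1 h1 i (Finset.mem_univ i)
  simpa using this

/-- Two-sided bounds for the inverse of a uniformly positive Hermitian matrix. -/
theorem Matrix.IsHermitian.inv_form_bounds {n : ℕ} (hn : 1 ≤ n) {A : Matrix (Fin n) (Fin n) ℂ}
    {σ : ℝ} (hσ : 0 < σ) (hA : A.IsHermitian)
    (hlow : ∀ v : Fin n → ℂ, σ⁻¹ * ∑ i, ‖v i‖ ^ 2 ≤ (star v ⬝ᵥ A.mulVec v).re)
    (hupp : ∀ v : Fin n → ℂ, (star v ⬝ᵥ A.mulVec v).re ≤ σ * ∑ i, ‖v i‖ ^ 2) (v : Fin n → ℂ) :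
    (n ^ 2 * σ ^ 3)⁻¹ * ∑ i, ‖v i‖ ^ 2 ≤ (star v ⬝ᵥ A⁻¹.mulVec v).re ∧
      (star v ⬝ᵥ A⁻¹.mulVec v).re ≤ σ * ∑ i, ‖v i‖ ^ 2 := by
  have hσi : 0 < σ⁻¹ := inv_pos.2 hσ
  have hdet := Matrix.isUnit_det_of_form_pos hσi hlow
  have hent := hA.norm_apply_le (s := σ) (fun v => le_trans (by positivity) (hlow v)) hupp
  set u := A⁻¹.mulVec v with hu
  have hv : A.mulVec u = v := by
    rw [hu, Matrix.mulVec_mulVec, Matrix.mul_nonsing_inv _ hdet, Matrix.one_mulVec]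
  have hsym : (star v ⬝ᵥ u).re = (star u ⬝ᵥ A.mulVec u).re := by
    rw [hv, dotProduct, dotProduct, Complex.re_sum, Complex.re_sum]
    exact Finset.sum_congr rfl fun i _ => by simp; ring
  have hl := hlow u
  rw [← hsym] at hl
  constructor
  · have h1 : ∀ i, ‖v i‖ ^ 2 ≤ σ ^ 2 * (n * ∑ j, ‖u j‖ ^ 2) := fun i => by
      have h2 : ‖v i‖ ≤ σ * ∑ j, ‖u j‖ := by
        rw [← hv, Matrix.mulVec, dotProduct, Finset.mul_sum]
        refine (norm_sum_le _ _).trans (Finset.sum_le_sum fun j _ => ?_)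
        rw [norm_mul]
        exact mul_le_mul_of_nonneg_right (hent i j) (norm_nonneg _)
      calc ‖v i‖ ^ 2 ≤ (σ * ∑ j, ‖u j‖) ^ 2 := pow_le_pow_left₀ (norm_nonneg _) h2 2
        _ = σ ^ 2 * (∑ j, ‖u j‖) ^ 2 := by ring
        _ ≤ _ := mul_le_mul_of_nonneg_left (sq_sum_norm_le u) (by positivity)
    have h3 : ∑ i, ‖v i‖ ^ 2 ≤ n ^ 2 * σ ^ 2 * ∑ j, ‖u j‖ ^ 2 := by
      refine (Finset.sum_le_sum fun i _ => h1 i).trans (le_of_eq ?_)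
      simp
      ring
    have hn0 : (0 : ℝ) < n := by exact_mod_cast hn
    refine le_trans ?_ hl
    rw [inv_mul_le_iff₀ (by positivity)]
    refine h3.trans (le_of_eq ?_)
    field_simp
  · have h2 : (star v ⬝ᵥ u).re ≤ (σ * ∑ i, ‖v i‖ ^ 2 + σ⁻¹ * ∑ i, ‖u i‖ ^ 2) / 2 := by
      rw [Finset.mul_sum, Finset.mul_sum, ← Finset.sum_add_distrib, Finset.sum_div]
      refine (Complex.re_le_norm _).trans ((norm_sum_le _ _).trans
        (Finset.sum_le_sum fun i _ => ?_))
      rw [norm_mul, Pi.star_apply, norm_star]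
      have h3 : 0 ≤ σ⁻¹ * (σ * ‖v i‖ - ‖u i‖) ^ 2 := by positivity
      have h4 : σ⁻¹ * (σ * ‖v i‖ - ‖u i‖) ^ 2 =
          σ * ‖v i‖ ^ 2 + σ⁻¹ * ‖u i‖ ^ 2 - 2 * (‖v i‖ * ‖u i‖) := by
        field_simp
        ring
      linarith
    linarith

theorem norm_inv_sub_inv_apply_le {n : ℕ} {A B : Matrix (Fin n) (Fin n) ℂ} {σ μ : ℝ}
    (hσ : 0 ≤ σ) (hA : IsUnit A.det) (hB : IsUnit B.det) (hAi : ∀ i j, ‖A⁻¹ i j‖ ≤ σ)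
    (hBi : ∀ i j, ‖B⁻¹ i j‖ ≤ σ) (hAB : ∀ i j, ‖A i j - B i j‖ ≤ μ) (i j : Fin n) :
    ‖(B⁻¹ - A⁻¹) i j‖ ≤ n ^ 2 * σ ^ 2 * μ := by
  have h : B⁻¹ - A⁻¹ = B⁻¹ * (A - B) * A⁻¹ := by
    rw [Matrix.mul_sub, Matrix.sub_mul, Matrix.mul_assoc, Matrix.mul_nonsing_inv _ hA,
      Matrix.nonsing_inv_mul _ hB, Matrix.mul_one, Matrix.one_mul]
  rw [h, Matrix.mul_apply]
  calc ‖∑ k, (B⁻¹ * (A - B)) i k * A⁻¹ k j‖ ≤ ∑ k : Fin n, (∑ l : Fin n, σ * μ) * σ := by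
        refine (norm_sum_le _ _).trans (Finset.sum_le_sum fun k _ => ?_)
        rw [norm_mul, Matrix.mul_apply]
        refine mul_le_mul ((norm_sum_le _ _).trans (Finset.sum_le_sum fun l _ => ?_)) (hAi k j)
          (norm_nonneg _) ?_
        · rw [norm_mul]
          exact mul_le_mul (hBi i l) (hAB l k) (norm_nonneg _) hσ
        · exact Finset.sum_nonneg fun l _ => mul_nonneg hσ ((norm_nonneg _).trans (hAB l k))
    _ = _ := by simp; ring

theorem norm_wirt_sq_le {n : ℕ} (k : Fin n) (f : EuclideanSpace ℂ (Fin n) → ℂ)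
    (z : EuclideanSpace ℂ (Fin n)) : ‖wirt n k f z‖ ^ 2 ≤ gradSq (fderiv ℝ f z) := by
  have h1 : ‖wirt n k f z‖ ≤ (‖pdx n k f z‖ + ‖pdy n k f z‖) / 2 := by
    rw [wirt, norm_div, Complex.norm_ofNat]
    gcongr
    exact (norm_sub_le _ _).trans (by simp)
  have h2 : ‖pdx n k f z‖ ^ 2 + ‖pdy n k f z‖ ^ 2 ≤ gradSq (fderiv ℝ f z) :=
    Finset.single_le_sum (f := fun k => ‖pdx n k f z‖ ^ 2 + ‖pdy n k f z‖ ^ 2)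
      (fun i _ => by positivity) (Finset.mem_univ k)
  nlinarith [norm_nonneg (wirt n k f z), sq_nonneg (‖pdx n k f z‖ - ‖pdy n k f z‖)]

theorem norm_wirtBar_sq_le {n : ℕ} (k : Fin n) (f : EuclideanSpace ℂ (Fin n) → ℂ)
    (z : EuclideanSpace ℂ (Fin n)) : ‖wirtBar n k f z‖ ^ 2 ≤ gradSq (fderiv ℝ f z) := by
  have h1 : ‖wirtBar n k f z‖ ≤ (‖pdx n k f z‖ + ‖pdy n k f z‖) / 2 := by
    rw [wirtBar, norm_div, Complex.norm_ofNat]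
    gcongr
    exact (norm_add_le _ _).trans (by simp)
  have h2 : ‖pdx n k f z‖ ^ 2 + ‖pdy n k f z‖ ^ 2 ≤ gradSq (fderiv ℝ f z) :=
    Finset.single_le_sum (f := fun k => ‖pdx n k f z‖ ^ 2 + ‖pdy n k f z‖ ^ 2)
      (fun i _ => by positivity) (Finset.mem_univ k)
  nlinarith [norm_nonneg (wirtBar n k f z), sq_nonneg (‖pdx n k f z‖ - ‖pdy n k f z‖)]

theorem leviCoeff_fderiv_fderiv {n : ℕ} {u : EuclideanSpace ℂ (Fin n) → ℂ}
    {z : EuclideanSpace ℂ (Fin n)} (hu : ContDiffAt ℝ 2 u z) (k l : Fin n) :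
    leviCoeff (fderiv ℝ (fderiv ℝ u) z) k l = 4 * wirt n k (fun w => wirtBar n l u w) z := by
  have h1 : DifferentiableAt ℝ (fderiv ℝ u) z :=
    (hu.fderiv_right (m := 1) (by norm_num)).differentiableAt (by simp)
  have h2 : ∀ a, HasFDerivAt (fun w => fderiv ℝ u w a)
      ((ContinuousLinearMap.apply ℝ ℂ a).comp (fderiv ℝ (fderiv ℝ u) z)) z := fun a =>
    (ContinuousLinearMap.apply ℝ ℂ a).hasFDerivAt.comp z h1.hasFDerivAt
  have h3 : ∀ v, fderiv ℝ (fun w => wirtBar n l u w) z v =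
      (fderiv ℝ (fderiv ℝ u) z v (EuclideanSpace.single l 1) +
        Complex.I * fderiv ℝ (fderiv ℝ u) z v (EuclideanSpace.single l Complex.I)) * 2⁻¹ := by
    intro v
    have h4 := ((h2 (EuclideanSpace.single l 1)).add
      ((h2 (EuclideanSpace.single l Complex.I)).const_mul Complex.I)).mul_const (2⁻¹ : ℂ)
    have h5 : (fun w => wirtBar n l u w) = fun w => (fderiv ℝ u w (EuclideanSpace.single l 1) +
        Complex.I * fderiv ℝ u w (EuclideanSpace.single l Complex.I)) * 2⁻¹ := by
      funext w
      rw [wirtBar, div_eq_mul_inv, pdx, pdy]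
    rw [h5]
    refine (congrArg (fun F => F v) h4.fderiv).trans ?_
    simp
    ring
  rw [wirt, pdx, pdy, h3, h3, leviCoeff]
  linear_combination fderiv ℝ (fderiv ℝ u) z (EuclideanSpace.single k Complex.I)
    (EuclideanSpace.single l Complex.I) * Complex.I_sq

theorem EllipticSolution.contDiffAt {n : ℕ} {α σ Λ M c : ℝ}
    {g H : EuclideanSpace ℂ (Fin n) → Matrix (Fin n) (Fin n) ℂ}
    (h : EllipticSolution n α σ Λ M c g H) {z : EuclideanSpace ℂ (Fin n)}
    (hz : z ∈ Metric.ball (0 : EuclideanSpace ℂ (Fin n)) 1) (i j : Fin n) :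
    ContDiffAt ℝ 2 (fun w => g w i j) z :=
  ((h.1 i j).contDiffAt (Metric.isOpen_ball.mem_nhds hz)).of_le
    (WithTop.coe_le_coe.2 le_top)

theorem EllipticSolution.form_bounds {n : ℕ} {α σ Λ M c : ℝ}
    {g H : EuclideanSpace ℂ (Fin n) → Matrix (Fin n) (Fin n) ℂ}
    (h : EllipticSolution n α σ Λ M c g H) {z : EuclideanSpace ℂ (Fin n)}
    (hz : z ∈ Metric.ball (0 : EuclideanSpace ℂ (Fin n)) 1) (v : Fin n → ℂ) :
    σ⁻¹ * ∑ i, ‖v i‖ ^ 2 ≤ (star v ⬝ᵥ (g z).mulVec v).re ∧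
      (star v ⬝ᵥ (g z).mulVec v).re ≤ σ * ∑ i, ‖v i‖ ^ 2 := by
  rw [← re_star_dotProduct_self]
  exact h.2.2.1 z hz v

theorem EllipticSolution.norm_le {n : ℕ} {α σ Λ M c : ℝ} (hσ : 0 < σ)
    {g H : EuclideanSpace ℂ (Fin n) → Matrix (Fin n) (Fin n) ℂ}
    (h : EllipticSolution n α σ Λ M c g H) {z : EuclideanSpace ℂ (Fin n)}
    (hz : z ∈ Metric.ball (0 : EuclideanSpace ℂ (Fin n)) 1) (i j : Fin n) : ‖g z i j‖ ≤ σ :=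
  (h.2.1 z hz).norm_apply_le
    (fun v => le_trans (by positivity) (h.form_bounds hz v).1)
    (fun v => (h.form_bounds hz v).2) i j

theorem EllipticSolution.isUnit_det {n : ℕ} {α σ Λ M c : ℝ} (hσ : 0 < σ)
    {g H : EuclideanSpace ℂ (Fin n) → Matrix (Fin n) (Fin n) ℂ}
    (h : EllipticSolution n α σ Λ M c g H) {z : EuclideanSpace ℂ (Fin n)}
    (hz : z ∈ Metric.ball (0 : EuclideanSpace ℂ (Fin n)) 1) : IsUnit (g z).det :=
  Matrix.isUnit_det_of_form_pos (inv_pos.2 hσ) fun v => (h.form_bounds hz v).1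

theorem EllipticSolution.inv_form_bounds {n : ℕ} (hn : 1 ≤ n) {α σ Λ M c : ℝ} (hσ : 0 < σ)
    {g H : EuclideanSpace ℂ (Fin n) → Matrix (Fin n) (Fin n) ℂ}
    (h : EllipticSolution n α σ Λ M c g H) {z : EuclideanSpace ℂ (Fin n)}
    (hz : z ∈ Metric.ball (0 : EuclideanSpace ℂ (Fin n)) 1) (v : Fin n → ℂ) :
    (n ^ 2 * σ ^ 3)⁻¹ * ∑ i, ‖v i‖ ^ 2 ≤ (star v ⬝ᵥ (g z)⁻¹.mulVec v).re ∧
      (star v ⬝ᵥ (g z)⁻¹.mulVec v).re ≤ σ * ∑ i, ‖v i‖ ^ 2 :=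
  (h.2.1 z hz).inv_form_bounds hn hσ (fun v => (h.form_bounds hz v).1)
    (fun v => (h.form_bounds hz v).2) v

theorem EllipticSolution.norm_inv_le {n : ℕ} (hn : 1 ≤ n) {α σ Λ M c : ℝ} (hσ : 0 < σ)
    {g H : EuclideanSpace ℂ (Fin n) → Matrix (Fin n) (Fin n) ℂ}
    (h : EllipticSolution n α σ Λ M c g H) {z : EuclideanSpace ℂ (Fin n)}
    (hz : z ∈ Metric.ball (0 : EuclideanSpace ℂ (Fin n)) 1) (i j : Fin n) :
    ‖(g z)⁻¹ i j‖ ≤ σ :=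
  (h.2.1 z hz).inv.norm_apply_le
    (fun v => le_trans (by positivity) (h.inv_form_bounds hn hσ hz v).1)
    (fun v => (h.inv_form_bounds hn hσ hz v).2) i j

theorem gradSq_le_sum {n : ℕ} {ι : Type*} [Fintype ι]
    (D : ι → EuclideanSpace ℂ (Fin n) →L[ℝ] ℂ) (i : ι) : gradSq (D i) ≤ ∑ i, gradSq (D i) :=
  Finset.single_le_sum (f := fun i => gradSq (D i)) (fun i _ => gradSq_nonneg (D i))
    (Finset.mem_univ i)

/-- The equation bounds the principal part by the square of the gradient. -/
theorem EllipticSolution.norm_leviTrace_le {n : ℕ} (hn : 1 ≤ n) {α σ Λ M c : ℝ} (hσ : 1 ≤ σ)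
    {g H : EuclideanSpace ℂ (Fin n) → Matrix (Fin n) (Fin n) ℂ}
    (h : EllipticSolution n α σ Λ M c g H) {z : EuclideanSpace ℂ (Fin n)}
    (hz : z ∈ Metric.ball (0 : EuclideanSpace ℂ (Fin n)) 1) (i j : Fin n) :
    ‖leviTrace (fderiv ℝ (fderiv ℝ (fun w => g w i j)) z) (g z)⁻¹‖ ≤
      4 * (n ^ 4 * σ ^ 2 *
        (∑ q : Fin n × Fin n, gradSq (fderiv ℝ (fun w => g w q.1 q.2) z)) + σ * Λ) := by
  have hσ0 : 0 < σ := by linarith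
  have hS1 : ∀ a b, gradSq (fderiv ℝ (fun w => g w a b) z) ≤
      ∑ q : Fin n × Fin n, gradSq (fderiv ℝ (fun w => g w q.1 q.2) z) := fun a b =>
    gradSq_le_sum (fun q : Fin n × Fin n => fderiv ℝ (fun w => g w q.1 q.2) z) (a, b)
  generalize (∑ q : Fin n × Fin n, gradSq (fderiv ℝ (fun w => g w q.1 q.2) z)) = S at hS1 ⊢
  have hT : leviTrace (fderiv ℝ (fderiv ℝ (fun w => g w i j)) z) (g z)⁻¹ =
      4 * ∑ k : Fin n, ∑ l : Fin n,
        ((g z)⁻¹ l k) * wirt n k (fun w => wirtBar n l (fun w' => g w' i j) w) z := by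
    simp only [leviTrace, leviCoeff_fderiv_fderiv (h.contDiffAt hz i j), Finset.mul_sum]
    exact Finset.sum_congr rfl fun k _ => Finset.sum_congr rfl fun l _ => by ring
  have hterm : ∀ k m p l, ‖(g z)⁻¹ m k * (g z)⁻¹ l p * wirt n p (fun w => g w i m) z *
      wirtBar n l (fun w => g w k j) z‖ ≤ σ * σ * S := by
    intro k m p l
    have h1 := (norm_wirt_sq_le p (fun w => g w i m) z).trans (hS1 i m)
    have h2 := (norm_wirtBar_sq_le l (fun w => g w k j) z).trans (hS1 k j)
    have h3 := h.norm_inv_le hn hσ0 hz m k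
    have h4 := h.norm_inv_le hn hσ0 hz l p
    generalize wirt n p (fun w => g w i m) z = a at h1 ⊢
    generalize wirtBar n l (fun w => g w k j) z = b at h2 ⊢
    generalize (g z)⁻¹ m k = a' at h3 ⊢
    generalize (g z)⁻¹ l p = b' at h4 ⊢
    rw [norm_mul, norm_mul, norm_mul, mul_assoc (‖a'‖ * ‖b'‖)]
    refine mul_le_mul (mul_le_mul h3 h4 (norm_nonneg _) hσ0.le) ?_ (by positivity) (by positivity)
    nlinarith [sq_nonneg (‖a‖ - ‖b‖)]
  have hQ : ‖∑ k : Fin n, ∑ m : Fin n, ∑ p : Fin n, ∑ l : Fin n,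
        ((g z)⁻¹ m k) * ((g z)⁻¹ l p) *
          wirt n p (fun w => g w i m) z * wirtBar n l (fun w => g w k j) z‖ ≤
      n ^ 4 * σ ^ 2 * S := by
    refine (norm_sum_le_of_le _ fun k _ => norm_sum_le_of_le _ fun m _ =>
      norm_sum_le_of_le _ fun p _ => norm_sum_le_of_le _ fun l _ => hterm k m p l).trans
      (le_of_eq ?_)
    simp
    ring
  have hR : ‖(c : ℂ) * g z i j + H z i j‖ ≤ σ * Λ := by
    have h1 := h.2.2.2.2.1 z hz i j
    have h2 := h.norm_le hσ0 hz i j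
    calc ‖(c : ℂ) * g z i j + H z i j‖ ≤ |c| * ‖g z i j‖ + ‖H z i j‖ := by
          refine (norm_add_le _ _).trans (le_of_eq ?_)
          rw [norm_mul, Complex.norm_real, Real.norm_eq_abs]
      _ ≤ σ * (|c| + ‖H z i j‖) := by
          nlinarith [mul_le_mul_of_nonneg_left h2 (abs_nonneg c), norm_nonneg (H z i j)]
      _ ≤ σ * Λ := mul_le_mul_of_nonneg_left h1 hσ0.le
  have heq := sub_eq_iff_eq_add.1 (h.2.2.2.2.2.2 z hz i j)
  rw [hT, norm_mul, Complex.norm_ofNat, heq]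
  refine mul_le_mul_of_nonneg_left ?_ (by norm_num)
  rw [add_comm (_ * S)]
  exact (norm_add_le _ _).trans (add_le_add hR hQ)

theorem leviTrace_sum_smul {n : ℕ} {ι : Type*} [Fintype ι] (c : ι → ℂ)
    (F : ι → EuclideanSpace ℂ (Fin n) →L[ℝ] EuclideanSpace ℂ (Fin n) →L[ℝ] ℂ)
    (Q : Matrix (Fin n) (Fin n) ℂ) :
    leviTrace (∑ i, c i • F i) Q = ∑ i, c i * leviTrace (F i) Q := by
  have h : ∀ k l, leviCoeff (∑ i, c i • F i) k l = ∑ i, c i * leviCoeff (F i) k l := by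
    intro k l
    simp only [leviCoeff, _root_.sum_apply, _root_.smul_apply,
      smul_eq_mul, ← Finset.sum_add_distrib, ← Finset.sum_sub_distrib, Finset.mul_sum]
    exact Finset.sum_congr rfl fun i _ => by ring
  simp only [leviTrace, h, Finset.mul_sum]
  rw [Finset.sum_congr rfl fun k _ => Finset.sum_comm, Finset.sum_comm]
  exact Finset.sum_congr rfl fun i _ => Finset.sum_congr rfl fun k _ =>
    Finset.sum_congr rfl fun l _ => by ring

theorem sum_smul_fderiv_fderiv_symm {n : ℕ} {ι : Type*} [Fintype ι] (c : ι → ℂ)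
    {g : ι → EuclideanSpace ℂ (Fin n) → ℂ} {z : EuclideanSpace ℂ (Fin n)}
    (hg : ∀ i, ContDiffAt ℝ 2 (g i) z) (v w : EuclideanSpace ℂ (Fin n)) :
    (∑ i, c i • fderiv ℝ (fderiv ℝ (g i)) z) v w =
      (∑ i, c i • fderiv ℝ (fderiv ℝ (g i)) z) w v := by
  simp only [_root_.sum_apply, _root_.smul_apply]
  refine Finset.sum_congr rfl fun i _ => ?_
  rw [((hg i).isSymmSndFDerivAt (by simp)).eq]

theorem abs_re_leviTrace_sum_smul_le {n : ℕ} {ι : Type*} [Fintype ι] {c : ι → ℂ} {b T : ℝ}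
    (hc : ∀ i, ‖c i‖ ≤ b)
    {F : ι → EuclideanSpace ℂ (Fin n) →L[ℝ] EuclideanSpace ℂ (Fin n) →L[ℝ] ℂ}
    {Q : Matrix (Fin n) (Fin n) ℂ} (hF : ∀ i, ‖leviTrace (F i) Q‖ ≤ T) :
    |(leviTrace (∑ i, c i • F i) Q).re| ≤ Fintype.card ι * (b * T) := by
  refine (Complex.abs_re_le_norm _).trans ?_
  rw [leviTrace_sum_smul]
  calc ‖∑ i, c i * leviTrace (F i) Q‖ ≤ ∑ _i : ι, b * T := by
        refine norm_sum_le_of_le _ fun i _ => ?_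
        rw [norm_mul]
        exact mul_le_mul (hc i) (hF i) (norm_nonneg _) ((norm_nonneg _).trans (hc i))
    _ = _ := by simp

theorem re_form_add_smul_one {n : ℕ} (A : Matrix (Fin n) (Fin n) ℂ) (s : ℝ) (v : Fin n → ℂ) :
    (star v ⬝ᵥ (A + (s : ℂ) • 1).mulVec v).re =
      (star v ⬝ᵥ A.mulVec v).re + s * ∑ i, ‖v i‖ ^ 2 := by
  rw [Matrix.add_mulVec, Matrix.smul_mulVec, Matrix.one_mulVec, dotProduct_add, dotProduct_smul,
    Complex.add_re, smul_eq_mul, Complex.re_ofReal_mul, re_star_dotProduct_self]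

theorem EllipticSolution.mul_le_of_isLocalMax {n : ℕ} (hn : 1 ≤ n) {α σ Λ M c : ℝ} (hσ : 1 ≤ σ)
    {g H : EuclideanSpace ℂ (Fin n) → Matrix (Fin n) (Fin n) ℂ}
    (h : EllipticSolution n α σ Λ M c g H) {x₀ x y : EuclideanSpace ℂ (Fin n)}
    (hx : x ∈ Metric.ball (0 : EuclideanSpace ℂ (Fin n)) 1)
    (hy : y ∈ Metric.ball (0 : EuclideanSpace ℂ (Fin n)) 1) (hxy : x ≠ y) (hxy1 : ‖x - y‖ ≤ 1)
    {θ : Fin n × Fin n → ℂ} (hθ : ∀ q, ‖θ q‖ ≤ 1) {N K L γ ε μ : ℝ}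
    (hγ0 : 0 < γ) (hγ1 : γ < 1) (hN : 0 ≤ N) (hK : 0 ≤ K) (hL : 0 ≤ L) (hε : 0 ≤ ε)
    (hμ : ∀ i j, ‖g x i j - g y i j‖ ≤ μ)
    (hεδ : (4 + 5 * n) * ε ≤ 2 * (1 - γ) * (n ^ 2 * σ ^ 3)⁻¹)
    (hNε : 8 * n ^ 6 * σ ^ 2 ≤ N * ε) (hNμ : 2 * N * μ ≤ 1) (hμε : n ^ 3 * σ ^ 2 * μ ≤ ε / 2)
    (hmax : IsLocalMax (doublingFun (fun (q : Fin n × Fin n) w => g w q.1 q.2) θ N K L γ x₀)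
      (x, y)) :
    K * γ * (2 * (1 - γ) * (n ^ 2 * σ ^ 3)⁻¹) ≤ 16 * n ^ 2 * σ * Λ + 4 * L * n * σ := by
  have hσ0 : 0 < σ := by linarith
  have hn1 : (1 : ℝ) ≤ n := by exact_mod_cast hn
  set δ : ℝ := (n ^ 2 * σ ^ 3)⁻¹ with hδ
  have hδ0 : 0 < δ := by rw [hδ]; positivity
  have hr : 0 < ‖x - y‖ := norm_pos_iff.2 (sub_ne_zero.2 hxy)
  have hμ0 : 0 ≤ μ := (norm_nonneg _).trans (hμ ⟨0, hn⟩ ⟨0, hn⟩)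
  have hgx : ∀ q : Fin n × Fin n, ContDiffAt ℝ 2 (fun w => g w q.1 q.2) x := fun q =>
    h.contDiffAt hx q.1 q.2
  have hgy : ∀ q : Fin n × Fin n, ContDiffAt ℝ 2 (fun w => g w q.1 q.2) y := fun q =>
    h.contDiffAt hy q.1 q.2
  have hF := second_variation_nonpos (g := fun (q : Fin n × Fin n) w => g w q.1 q.2)
    hxy hgx hgy hmax
  have hc : ∀ q : Fin n × Fin n,
      ‖θ q + 2 * N * star (g x q.1 q.2 - g y q.1 q.2)‖ ≤ 2 := fun q => by
    refine (norm_add_le _ _).trans ?_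
    rw [norm_mul, norm_mul, norm_star, Complex.norm_ofNat, Complex.norm_real, Real.norm_eq_abs,
      abs_of_nonneg hN]
    have := mul_le_mul_of_nonneg_left (hμ q.1 q.2) (by linarith : 0 ≤ 2 * N)
    linarith [hθ q]
  have hTx := abs_re_leviTrace_sum_smul_le hc fun q : Fin n × Fin n =>
    h.norm_leviTrace_le hn hσ hx q.1 q.2
  have hTy := abs_re_leviTrace_sum_smul_le hc fun q : Fin n × Fin n =>
    h.norm_leviTrace_le hn hσ hy q.1 q.2
  have he : ‖‖x - y‖⁻¹ • (x - y)‖ = 1 := by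
    rw [norm_smul, norm_inv, norm_norm, inv_mul_cancel₀ hr.ne']
  have hdiff := norm_inv_sub_inv_apply_le hσ0.le (h.isUnit_det hσ0 hx) (h.isUnit_det hσ0 hy)
    (h.norm_inv_le hn hσ0 hx) (h.norm_inv_le hn hσ0 hy) hμ
  have hpow : 1 ≤ ‖x - y‖ ^ (γ - 2) :=
    Real.one_le_rpow_of_pos_of_le_one_of_nonpos hr hxy1 (by linarith)
  have hA0 : 0 ≤ K * γ * ‖x - y‖ ^ (γ - 2) := by positivity
  have hnε : 0 ≤ n * ε := by positivity
  have hεδ' : ε ≤ δ := by nlinarith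
  have hd0 : 0 ≤ n ^ 2 * σ ^ 2 * μ := by positivity
  have key := coupling_trace_le (sum_smul_fderiv_fderiv_symm _ hgx)
    (sum_smul_fderiv_fderiv_symm _ hgy)
    (DX := fun q : Fin n × Fin n => fderiv ℝ (fun w => g w q.1 q.2) x)
    (DY := fun q : Fin n × Fin n => fderiv ℝ (fun w => g w q.1 q.2) y)
    he hN hA0 (by linarith) hε hεδ' (h.2.1 x hx).inv (h.2.1 y hy).inv (δ := δ) (fun v => by
      have h1 := (h.inv_form_bounds hn hσ0 hx v).1
      have h2 := re_form_add_smul_one ((g x)⁻¹) (-δ) v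
      rw [Complex.ofReal_neg, neg_smul, ← sub_eq_add_neg] at h2
      rw [h2]
      linarith)
    (fun v => by
      rw [re_form_add_smul_one]
      have h1 := neg_le_of_abs_le (abs_re_star_dotProduct_mulVec_le hd0 hdiff v)
      have h2 : 0 ≤ ∑ i, ‖v i‖ ^ 2 := Finset.sum_nonneg fun i _ => by positivity
      have h3 := mul_le_mul_of_nonneg_right hμε h2
      linarith)
    (by
      rw [Matrix.trace, Complex.re_sum]
      calc ∑ i, ((((g y)⁻¹ - (g x)⁻¹).diag i).re) ≤ ∑ _i : Fin n, (n ^ 2 * σ ^ 2 * μ) :=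
            Finset.sum_le_sum fun i _ => (Complex.re_le_norm _).trans (hdiff i i)
        _ = n ^ 3 * σ ^ 2 * μ := by simp; ring
        _ ≤ ε / 2 := hμε
        _ ≤ n * (ε / 2) := by nlinarith)
    hF
  have htr : ((g x)⁻¹).trace.re ≤ n * σ := by
    rw [Matrix.trace, Complex.re_sum]
    calc ∑ i, (((g x)⁻¹.diag i).re) ≤ ∑ _i : Fin n, σ :=
          Finset.sum_le_sum fun i _ => re_diag_le (fun v => (h.inv_form_bounds hn hσ0 hx v).2) i
      _ = n * σ := by simp
  have hcard : (Fintype.card (Fin n × Fin n) : ℝ) = n ^ 2 := by simp [sq]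
  rw [hcard] at hTx hTy
  rw [Finset.sum_add_distrib] at key
  have hSx : 0 ≤ ∑ q : Fin n × Fin n, gradSq (fderiv ℝ (fun w => g w q.1 q.2) x) :=
    Finset.sum_nonneg fun q _ => gradSq_nonneg (fderiv ℝ (fun w => g w q.1 q.2) x)
  have hSy : 0 ≤ ∑ q : Fin n × Fin n, gradSq (fderiv ℝ (fun w => g w q.1 q.2) y) :=
    Finset.sum_nonneg fun q _ => gradSq_nonneg (fderiv ℝ (fun w => g w q.1 q.2) y)
  generalize (∑ q : Fin n × Fin n, gradSq (fderiv ℝ (fun w => g w q.1 q.2) x)) = Sx at *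
  generalize (∑ q : Fin n × Fin n, gradSq (fderiv ℝ (fun w => g w q.1 q.2) y)) = Sy at *
  have k1 := neg_le_of_abs_le hTx
  have k2 := le_of_abs_le hTy
  have k3 := mul_le_mul_of_nonneg_right hNε (add_nonneg hSx hSy)
  have k4 := mul_le_mul_of_nonneg_left htr (by linarith : 0 ≤ 4 * L)
  have k5 : K * γ * (2 * (1 - γ) * δ) ≤
      K * γ * ‖x - y‖ ^ (γ - 2) * (4 * (1 - γ) * (δ - ε) - 5 * n * ε) := by
    have h1 : 2 * (1 - γ) * δ ≤ 4 * (1 - γ) * (δ - ε) - 5 * n * ε := by nlinarith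
    have h2 : 0 ≤ 2 * (1 - γ) * δ := mul_nonneg (by linarith) hδ0.le
    have h3 : K * γ ≤ K * γ * ‖x - y‖ ^ (γ - 2) := le_mul_of_one_le_right (by positivity) hpow
    exact mul_le_mul h3 h1 h2 hA0
  linarith

theorem continuousOn_doublingFun {n : ℕ} {ι : Type*} [Fintype ι]
    {g : ι → EuclideanSpace ℂ (Fin n) → ℂ} {θ : ι → ℂ} {N K L γ : ℝ} (hγ : 0 ≤ γ)
    {x₀ : EuclideanSpace ℂ (Fin n)} {s : Set (EuclideanSpace ℂ (Fin n))}
    (hg : ∀ i, ContinuousOn (g i) s) : ContinuousOn (doublingFun g θ N K L γ x₀) (s ×ˢ s) := by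
  have hd : ∀ i, ContinuousOn (fun q : EuclideanSpace ℂ (Fin n) × EuclideanSpace ℂ (Fin n) =>
      g i q.1 - g i q.2) (s ×ˢ s) := fun i =>
    ((hg i).comp continuousOn_fst fun q hq => hq.1).sub
      ((hg i).comp continuousOn_snd fun q hq => hq.2)
  have h1 : ContinuousOn (fun q : EuclideanSpace ℂ (Fin n) × EuclideanSpace ℂ (Fin n) =>
      (∑ i, θ i * (g i q.1 - g i q.2)).re) (s ×ˢ s) :=
    Complex.continuous_re.comp_continuousOn
      (continuousOn_finsetSum _ fun i _ => continuousOn_const.mul (hd i))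
  have h2 : ContinuousOn (fun q : EuclideanSpace ℂ (Fin n) × EuclideanSpace ℂ (Fin n) =>
      N * ∑ i, ‖g i q.1 - g i q.2‖ ^ 2) (s ×ˢ s) :=
    continuousOn_const.mul (continuousOn_finsetSum _ fun i _ => (hd i).norm.pow 2)
  have h3 : Continuous (fun q : EuclideanSpace ℂ (Fin n) × EuclideanSpace ℂ (Fin n) =>
      K * ‖q.1 - q.2‖ ^ γ) :=
    continuous_const.mul ((continuous_fst.sub continuous_snd).norm.rpow_const fun _ => Or.inr hγ)
  have h4 : Continuous (fun q : EuclideanSpace ℂ (Fin n) × EuclideanSpace ℂ (Fin n) =>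
      L * ‖q.1 - x₀‖ ^ 2) :=
    continuous_const.mul ((continuous_fst.sub continuous_const).norm.pow 2)
  exact ((h1.add h2).sub h3.continuousOn).sub h4.continuousOn

/-- The doubled function is nonpositive near its centre when the penalization is strong enough. -/
theorem EllipticSolution.doublingFun_nonpos {n : ℕ} (hn : 1 ≤ n) {α σ Λ M c : ℝ}
    (hα : 0 ≤ α) (hσ : 1 ≤ σ)
    {g H : EuclideanSpace ℂ (Fin n) → Matrix (Fin n) (Fin n) ℂ}
    (h : EllipticSolution n α σ Λ M c g H) {x₀ : EuclideanSpace ℂ (Fin n)}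
    (hx₀ : x₀ ∈ Metric.ball (0 : EuclideanSpace ℂ (Fin n)) (3 / 4))
    {θ : Fin n × Fin n → ℂ} (hθ : ∀ q, ‖θ q‖ ≤ 1) {N K L γ ε μ r₀ : ℝ}
    (hγ0 : 0 < γ) (hγ1 : γ < 1) (hN : 0 ≤ N) (hK : 0 ≤ K) (hL : 0 ≤ L) (hε : 0 ≤ ε)
    (hr₀ : 0 < r₀) (hr₀1 : r₀ ≤ 1 / 16) (hμ : |M| * r₀ ^ α ≤ μ)
    (hεδ : (4 + 5 * n) * ε ≤ 2 * (1 - γ) * (n ^ 2 * σ ^ 3)⁻¹)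
    (hNε : 8 * n ^ 6 * σ ^ 2 ≤ N * ε) (hNμ : 2 * N * μ ≤ 1) (hμε : n ^ 3 * σ ^ 2 * μ ≤ ε / 2)
    (hKr : n ^ 2 * (2 * σ + N * (2 * σ) ^ 2) ≤ K * r₀ ^ γ)
    (hLr : n ^ 2 * (2 * σ + N * (2 * σ) ^ 2) ≤ L * (1 / 16) ^ 2)
    (hKL : 16 * n ^ 2 * σ * Λ + 4 * L * n * σ < K * γ * (2 * (1 - γ) * (n ^ 2 * σ ^ 3)⁻¹))
    {y : EuclideanSpace ℂ (Fin n)} (hy : y ∈ Metric.closedBall x₀ (1 / 8)) :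
    doublingFun (fun (q : Fin n × Fin n) w => g w q.1 q.2) θ N K L γ x₀ (x₀, y) ≤ 0 := by
  have hσ0 : 0 < σ := by linarith
  set Ψ := doublingFun (fun (q : Fin n × Fin n) w => g w q.1 q.2) θ N K L γ x₀ with hΨ
  have hsub : Metric.closedBall x₀ (1 / 8) ⊆
      Metric.ball (0 : EuclideanSpace ℂ (Fin n)) 1 := fun z hz => by
    rw [Metric.mem_closedBall] at hz
    rw [Metric.mem_ball] at hx₀ ⊢
    linarith [dist_triangle z x₀ 0]
  have hbound : ∀ p q : EuclideanSpace ℂ (Fin n), p ∈ Metric.closedBall x₀ (1 / 8) →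
      q ∈ Metric.closedBall x₀ (1 / 8) → Ψ (p, q) + K * ‖p - q‖ ^ γ + L * ‖p - x₀‖ ^ 2 ≤
        n ^ 2 * (2 * σ + N * (2 * σ) ^ 2) := by
    intro p q hp hq
    have hd : ∀ a : Fin n × Fin n, ‖g p a.1 a.2 - g q a.1 a.2‖ ≤ 2 * σ := fun a => by
      refine (norm_sub_le _ _).trans ?_
      linarith [h.norm_le hσ0 (hsub hp) a.1 a.2, h.norm_le hσ0 (hsub hq) a.1 a.2]
    have hcard : (Fintype.card (Fin n × Fin n) : ℝ) = n ^ 2 := by simp [sq]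
    have h1 : (∑ a : Fin n × Fin n, θ a * (g p a.1 a.2 - g q a.1 a.2)).re ≤ n ^ 2 * (2 * σ) := by
      refine (Complex.re_le_norm _).trans ((norm_sum_le_of_le (n := fun _ => 2 * σ) _
        fun a _ => ?_).trans ?_)
      · rw [norm_mul]
        calc _ ≤ 1 * (2 * σ) := mul_le_mul (hθ a) (hd a) (norm_nonneg _) zero_le_one
          _ = _ := one_mul _
      · rw [Finset.sum_const, Finset.card_univ, nsmul_eq_mul, hcard]
    have h2 : ∑ a : Fin n × Fin n, ‖g p a.1 a.2 - g q a.1 a.2‖ ^ 2 ≤ n ^ 2 * (2 * σ) ^ 2 := by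
      refine (Finset.sum_le_sum (g := fun _ => (2 * σ) ^ 2) fun a _ =>
        pow_le_pow_left₀ (norm_nonneg _) (hd a) 2).trans ?_
      rw [Finset.sum_const, Finset.card_univ, nsmul_eq_mul, hcard]
    have h3 := mul_le_mul_of_nonneg_left h2 hN
    rw [hΨ, doublingFun]
    linarith
  by_contra! hpos
  have hcont : ContinuousOn Ψ (Metric.closedBall x₀ (1 / 8) ×ˢ Metric.closedBall x₀ (1 / 8)) :=
    continuousOn_doublingFun hγ0.le fun q => (h.1 q.1 q.2).continuousOn.mono hsub
  have hmem : (x₀, y) ∈ Metric.closedBall x₀ (1 / 8) ×ˢ Metric.closedBall x₀ (1 / 8) :=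
    ⟨Metric.mem_closedBall_self (by norm_num), hy⟩
  obtain ⟨⟨p, q⟩, ⟨hp, hq⟩, hmax⟩ := ((isCompact_closedBall x₀ (1 / 8)).prod
    (isCompact_closedBall x₀ (1 / 8))).exists_isMaxOn ⟨_, hmem⟩ hcont
  have hpq : 0 < Ψ (p, q) := hpos.trans_le (hmax hmem)
  have hb := hbound p q hp hq
  have hL0 : 0 ≤ L * ‖p - x₀‖ ^ 2 := by positivity
  have hK0 : 0 ≤ K * ‖p - q‖ ^ γ := by positivity
  have hne : p ≠ q := by
    rintro rfl
    have : Ψ (p, p) = - (L * ‖p - x₀‖ ^ 2) := by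
      simp [hΨ, doublingFun, Real.zero_rpow hγ0.ne']
    linarith
  have hr : ‖p - q‖ < r₀ := by
    by_contra! hcon
    have := mul_le_mul_of_nonneg_left (Real.rpow_le_rpow hr₀.le hcon hγ0.le) hK
    linarith
  have hpx : ‖p - x₀‖ < 1 / 16 := by
    by_contra! hcon
    have := mul_le_mul_of_nonneg_left (pow_le_pow_left₀ (by norm_num) hcon 2) hL
    linarith
  have hp' : p ∈ Metric.ball x₀ (1 / 8) := by
    rw [Metric.mem_ball, dist_eq_norm]
    linarith
  have hq' : q ∈ Metric.ball x₀ (1 / 8) := by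
    rw [Metric.mem_ball, dist_eq_norm]
    have := norm_sub_le_norm_sub_add_norm_sub q p x₀
    rw [norm_sub_rev q p] at this
    linarith
  have hloc : IsLocalMax Ψ (p, q) := by
    refine hmax.isLocalMax (Filter.mem_of_superset
      ((Metric.isOpen_ball.prod Metric.isOpen_ball).mem_nhds ⟨hp', hq'⟩)
      (Set.prod_mono Metric.ball_subset_closedBall Metric.ball_subset_closedBall))
  have hμ' : ∀ i j, ‖g p i j - g q i j‖ ≤ μ := fun i j => by
    refine (h.2.2.2.2.2.1 i j p (hsub hp) q (hsub hq)).trans (le_trans ?_ hμ)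
    exact mul_le_mul (le_abs_self M) (Real.rpow_le_rpow (norm_nonneg _) hr.le hα)
      (by positivity) (abs_nonneg M)
  exact absurd (h.mul_le_of_isLocalMax hn hσ (hsub hp) (hsub hq) hne (by linarith) hθ hγ0 hγ1 hN
    hK hL hε hμ' hεδ hNε hNμ hμε hloc) (not_le.2 hKL)

/-- A Hölder bound follows from the nonpositivity of the doubled functions. -/
theorem norm_sub_le_of_doublingFun_nonpos {n : ℕ} {ι : Type*} [Fintype ι] [DecidableEq ι]
    {g : ι → EuclideanSpace ℂ (Fin n) → ℂ} {N K L γ : ℝ} (hN : 0 ≤ N)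
    {x y : EuclideanSpace ℂ (Fin n)}
    (h : ∀ θ : ι → ℂ, (∀ i, ‖θ i‖ ≤ 1) → doublingFun g θ N K L γ x (x, y) ≤ 0) (i : ι) :
    ‖g i x - g i y‖ ≤ 2 * (K * ‖x - y‖ ^ γ) := by
  have hs : ∀ ζ : ℂ, ‖ζ‖ ≤ 1 → (ζ * (g i x - g i y)).re ≤ K * ‖x - y‖ ^ γ := fun ζ hζ => by
    have h1 := h (Pi.single i ζ) fun j => by
      rcases eq_or_ne j i with rfl | hj
      · simpa using hζ
      · simp [hj]
    have h2 : 0 ≤ N * ∑ i, ‖g i x - g i y‖ ^ 2 := by positivity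
    have h3 : ∑ j, (Pi.single i ζ : ι → ℂ) j * (g j x - g j y) = ζ * (g i x - g i y) := by
      rw [Finset.sum_eq_single i (fun j _ hj => by simp [hj]) (by simp), Pi.single_eq_same]
    simp only [doublingFun, h3, sub_self, norm_zero] at h1
    linarith
  have h1 := hs 1 (by simp)
  have h2 := hs (-1) (by simp)
  have h3 := hs Complex.I (by simp)
  have h4 := hs (-Complex.I) (by simp)
  generalize g i x - g i y = a at *
  rw [one_mul] at h1
  rw [neg_one_mul, Complex.neg_re] at h2
  rw [neg_mul, Complex.neg_re] at h4
  rw [Complex.I_mul_re] at h3 h4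
  refine (Complex.norm_le_abs_re_add_abs_im a).trans ?_
  rw [neg_neg] at h4
  linarith [abs_le.2 ⟨neg_le.1 h2, h1⟩, abs_le.2 ⟨neg_le.1 h3, h4⟩]

/-- A choice of the constants in the doubling argument. -/
theorem exists_doubling_constants {n : ℕ} (hn : 1 ≤ n) {α σ : ℝ} (Λ M : ℝ) (hα : 0 < α)
    (hσ : 1 ≤ σ) {γ : ℝ} (hγ0 : 0 < γ) (hγ1 : γ < 1) :
    ∃ N K L ε μ r₀ : ℝ, 0 ≤ N ∧ 0 ≤ K ∧ 0 ≤ L ∧ 0 ≤ ε ∧ 0 < r₀ ∧ r₀ ≤ 1 / 16 ∧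
      |M| * r₀ ^ α ≤ μ ∧ (4 + 5 * n) * ε ≤ 2 * (1 - γ) * (n ^ 2 * σ ^ 3)⁻¹ ∧
      8 * n ^ 6 * σ ^ 2 ≤ N * ε ∧ 2 * N * μ ≤ 1 ∧ n ^ 3 * σ ^ 2 * μ ≤ ε / 2 ∧
      n ^ 2 * (2 * σ + N * (2 * σ) ^ 2) ≤ K * r₀ ^ γ ∧
      n ^ 2 * (2 * σ + N * (2 * σ) ^ 2) ≤ L * (1 / 16) ^ 2 ∧
      16 * n ^ 2 * σ * Λ + 4 * L * n * σ < K * γ * (2 * (1 - γ) * (n ^ 2 * σ ^ 3)⁻¹) := by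
  have hn0 : (0 : ℝ) < n := by exact_mod_cast hn
  have hσ0 : 0 < σ := by linarith
  have hγ2 : 0 < 1 - γ := by linarith
  have hδ : 0 < 2 * (1 - γ) * (n ^ 2 * σ ^ 3)⁻¹ := by positivity
  generalize 2 * (1 - γ) * ((n : ℝ) ^ 2 * σ ^ 3)⁻¹ = δ at *
  obtain ⟨ε, hε, hεδ⟩ : ∃ ε : ℝ, 0 < ε ∧ (4 + 5 * n) * ε ≤ δ :=
    ⟨δ / (4 + 5 * n), by positivity, by rw [mul_div_cancel₀ _ (by positivity)]⟩
  obtain ⟨N, hN, hNε⟩ : ∃ N : ℝ, 0 < N ∧ 8 * n ^ 6 * σ ^ 2 ≤ N * ε :=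
    ⟨8 * n ^ 6 * σ ^ 2 / ε, by positivity, by rw [div_mul_cancel₀ _ hε.ne']⟩
  obtain ⟨μ, hμ, hNμ, hμε⟩ : ∃ μ : ℝ, 0 < μ ∧ 2 * N * μ ≤ 1 ∧ n ^ 3 * σ ^ 2 * μ ≤ ε / 2 := by
    refine ⟨min (1 / (2 * N)) (ε / 2 / (n ^ 3 * σ ^ 2)), by positivity, ?_, ?_⟩
    · rw [mul_comm, ← le_div_iff₀ (by positivity)]
      exact min_le_left _ _
    · rw [mul_comm, ← le_div_iff₀ (by positivity)]
      exact min_le_right _ _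
  obtain ⟨r₀, hr₀, hr₀1, hM⟩ : ∃ r₀ : ℝ, 0 < r₀ ∧ r₀ ≤ 1 / 16 ∧ |M| * r₀ ^ α ≤ μ := by
    have hM0 : 0 < |M| + 1 := by positivity
    refine ⟨min (1 / 16) ((μ / (|M| + 1)) ^ α⁻¹), by positivity, min_le_left _ _, ?_⟩
    have h1 : (min (1 / 16) ((μ / (|M| + 1)) ^ α⁻¹)) ^ α ≤ μ / (|M| + 1) := by
      refine (Real.rpow_le_rpow (by positivity) (min_le_right _ _) hα.le).trans (le_of_eq ?_)
      exact Real.rpow_inv_rpow (by positivity) hα.ne'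
    calc _ ≤ (|M| + 1) * (μ / (|M| + 1)) :=
          mul_le_mul (by linarith) h1 (by positivity) hM0.le
      _ = μ := mul_div_cancel₀ _ hM0.ne'
  have hC : 0 < n ^ 2 * (2 * σ + N * (2 * σ) ^ 2) := by positivity
  generalize hCN : n ^ 2 * (2 * σ + N * (2 * σ) ^ 2) = C at hC
  obtain ⟨L, hL, hLC⟩ : ∃ L : ℝ, 0 < L ∧ C ≤ L * (1 / 16) ^ 2 :=
    ⟨C * 256, by positivity, by linarith⟩
  have hrγ : 0 < r₀ ^ γ := by positivity
  obtain ⟨K, hK, hKC, hKL⟩ : ∃ K : ℝ, 0 ≤ K ∧ C ≤ K * r₀ ^ γ ∧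
      16 * n ^ 2 * σ * Λ + 4 * L * n * σ < K * γ * δ := by
    set B := 16 * n ^ 2 * σ * Λ + 4 * L * n * σ
    refine ⟨C / r₀ ^ γ + (|B| + 1) / (γ * δ), by positivity, ?_, ?_⟩
    · rw [add_mul, div_mul_cancel₀ _ hrγ.ne']
      have : 0 ≤ (|B| + 1) / (γ * δ) * r₀ ^ γ := by positivity
      linarith
    · rw [mul_assoc, add_mul, div_mul_cancel₀ _ (by positivity)]
      have : 0 ≤ C / r₀ ^ γ * (γ * δ) := by positivity
      linarith [le_abs_self B]
  exact ⟨N, K, L, ε, μ, r₀, hN.le, hK, hL.le, hε.le, hr₀, hr₀1, hM, hεδ, hNε, hNμ, hμε,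
    hCN.trans_le hKC, hCN.trans_le hLC, hKL⟩

/-- interior `C^γ` estimate for every `α < γ < 1`, with a constant
depending only on `n, α, γ, σ, Λ, M`. -/
theorem stmt18 (n : ℕ) (hn : 1 ≤ n) (α σ Λ M : ℝ)
    (hα0 : 0 < α) (hα1 : α < 1) (hσ : 1 ≤ σ) :
    ∀ γ : ℝ, α < γ → γ < 1 →
    ∃ C : ℝ, ∀ (c : ℝ) (g H : EuclideanSpace ℂ (Fin n) → Matrix (Fin n) (Fin n) ℂ),
      EllipticSolution n α σ Λ M c g H →
      (∀ z ∈ Metric.ball (0 : EuclideanSpace ℂ (Fin n)) (3 / 4), ∀ i j : Fin n,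
        ‖g z i j‖ ≤ C) ∧
      (∀ z ∈ Metric.ball (0 : EuclideanSpace ℂ (Fin n)) (3 / 4),
        ∀ y ∈ Metric.ball (0 : EuclideanSpace ℂ (Fin n)) (3 / 4), ∀ i j : Fin n,
        ‖g z i j - g y i j‖ ≤ C * ‖z - y‖ ^ γ) := by
  intro γ hαγ hγ1
  have hγ0 : 0 < γ := hα0.trans hαγ
  have hσ0 : 0 < σ := by linarith
  obtain ⟨N, K, L, ε, μ, r₀, hN, hK, hL, hε, hr₀, hr₀1, hμ, hεδ, hNε, hNμ, hμε, hKr, hLr, hKL⟩ :=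
    exists_doubling_constants hn Λ M hα0 hσ hγ0 hγ1
  have hp : 0 < ((1 : ℝ) / 8) ^ γ := by positivity
  refine ⟨σ + 2 * K + 2 * σ / (1 / 8) ^ γ, fun c g H h => ?_⟩
  have hsub : Metric.ball (0 : EuclideanSpace ℂ (Fin n)) (3 / 4) ⊆ Metric.ball 0 1 :=
    Metric.ball_subset_ball (by norm_num)
  have hq : 0 ≤ 2 * σ / (1 / 8) ^ γ := by positivity
  refine ⟨fun z hz i j => (h.norm_le hσ0 (hsub hz) i j).trans (by linarith),
    fun z hz y hy i j => ?_⟩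
  have hr : 0 ≤ ‖z - y‖ ^ γ := by positivity
  rcases le_total ‖z - y‖ (1 / 8) with hzy | hzy
  · have h1 := norm_sub_le_of_doublingFun_nonpos (g := fun (q : Fin n × Fin n) w => g w q.1 q.2)
      hN (fun θ hθ => h.doublingFun_nonpos hn hα0.le hσ hz hθ hγ0 hγ1 hN hK hL hε hr₀ hr₀1 hμ hεδ
        hNε hNμ hμε hKr hLr hKL
        (by rwa [Metric.mem_closedBall, dist_comm, dist_eq_norm] : y ∈ _)) (i, j)
    have h2 : 0 ≤ (σ + 2 * σ / (1 / 8) ^ γ) * ‖z - y‖ ^ γ := by positivity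
    linarith
  · have h1 : ‖g z i j - g y i j‖ ≤ 2 * σ := (norm_sub_le _ _).trans (by
      linarith [h.norm_le hσ0 (hsub hz) i j, h.norm_le hσ0 (hsub hy) i j])
    have h2 : 2 * σ ≤ 2 * σ / (1 / 8) ^ γ * ‖z - y‖ ^ γ := by
      rw [div_mul_eq_mul_div, le_div_iff₀ hp]
      exact mul_le_mul_of_nonneg_left (Real.rpow_le_rpow (by norm_num) hzy hγ0.le) (by linarith)
    have h3 : 0 ≤ (σ + 2 * K) * ‖z - y‖ ^ γ := by positivity
    linarith
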